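/- Let n be a positive integer. There exists a positive integer N = N(n) such that if D is a finite digraph containing a linked set of size at least N, then one of the following holds: (1) D has a 4-eulerianizable subdigraph with a haven of order at least n; or (2) there is a representation of the complete graph K_n in D. -/

import Mathlib

/-- A directed path in the digraph with adjacency relation `A`: a nonempty list of
distinct vertices in which each consecutive pair is joined by an edge directed forwards. -/
def IsDipath {V : Type*} (A : V → V → Prop) (l : List V) : Prop :=
  l ≠ [] ∧ l.Nodup ∧ l.Chain' A

/-- A directed path all of whose vertices lie in the set `S`. -/
def DipathIn {V : Type*} (A : V → V → Prop) (S : Set V) (l : List V) : Prop :=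
  IsDipath A l ∧ ∀ v ∈ l, v ∈ S

/-- A directed path from `u` to `v`. -/
def DipathFromTo {V : Type*} (A : V → V → Prop) (l : List V) (u v : V) : Prop :=
  IsDipath A l ∧ l.head? = some u ∧ l.getLast? = some v

/-- The digraph with adjacency `A` is strongly connected on the vertex set `S`:
any vertex of `S` can reach any other by a directed path staying inside `S`. -/
def StrongOn {V : Type*} (A : V → V → Prop) (S : Set V) : Prop :=
  ∀ u ∈ S, ∀ v ∈ S, ∃ l : List V, DipathIn A S l ∧ l.head? = some u ∧ l.getLast? = some v

/-- `C` is (the vertex set of) a strong component of the subdigraph induced on `W`: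
a maximal nonempty strongly connected subset of `W`. -/
def IsStrongComponent {V : Type*} (A : V → V → Prop) (W C : Set V) : Prop :=
  C ⊆ W ∧ C.Nonempty ∧ StrongOn A C ∧
    ∀ C' : Set V, C ⊆ C' → C' ⊆ W → StrongOn A C' → C' = C

/-- `B` is a haven of order `w` in the digraph with adjacency `A` and vertex set `S`:
for every `Z ⊆ S` with `|Z| < w`, `B Z` is a strong component of the digraph minus `Z`,
and `B Z ⊆ B Z'` whenever `Z' ⊆ Z` (the haven axiom). -/
def IsHavenOn {V : Type*} (A : V → V → Prop) (S : Set V) (w : ℕ) (B : Finset V → Set V) : Prop :=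
  ∀ Z : Finset V, ↑Z ⊆ S → Z.card < w →
    IsStrongComponent A (S \ ↑Z) (B Z) ∧ ∀ Z' : Finset V, Z' ⊆ Z → B Z ⊆ B Z'

/-- The digraph with adjacency `A` and vertex set `S` has a haven of order `w`. -/
def HasHavenOn {V : Type*} (A : V → V → Prop) (S : Set V) (w : ℕ) : Prop :=
  ∃ B : Finset V → Set V, IsHavenOn A S w B

/-- The digraph with adjacency `A` (on its whole vertex type) has a haven of order `w`. -/
def HasHaven {V : Type*} (A : V → V → Prop) (w : ℕ) : Prop :=
  HasHavenOn A Set.univ w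

/-- A linkage from the finite set `S` to the finite set `T`: for each `a ∈ S`,
`P a` is a directed path from `a` to `τ a ∈ T`, and the paths are pairwise vertex-disjoint
(so the ends `τ a` are distinct vertices of `T`). -/
def IsLinkage {V : Type*} (A : V → V → Prop) (S T : Finset V)
    (P : V → List V) (τ : V → V) : Prop :=
  (∀ a ∈ S, τ a ∈ T ∧ DipathFromTo A (P a) a (τ a)) ∧
  ∀ a₁ ∈ S, ∀ a₂ ∈ S, a₁ ≠ a₂ → ∀ v ∈ P a₁, v ∉ P a₂

/-- `X` is linked: for every `S, T ⊆ X` with `|S| = |T|` there is a linkage of `|S|`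
pairwise vertex-disjoint directed paths from `S` to `T`. -/
def Linked {V : Type*} (A : V → V → Prop) (X : Finset V) : Prop :=
  ∀ S T : Finset V, S ⊆ X → T ⊆ X → S.card = T.card →
    ∃ (P : V → List V) (τ : V → V), IsLinkage A S T P τ

/-- `(S, A')` is a subdigraph of the digraph with adjacency `A`: every edge of `A'`
is an edge of `A` with both ends in `S`. -/
def IsSubdigraph {V : Type*} (A : V → V → Prop) (S : Set V) (A' : V → V → Prop) : Prop :=
  ∀ u v, A' u v → A u v ∧ u ∈ S ∧ v ∈ S

/-- The digraph with adjacency `A` and vertex set `S` is `k`-eulerianizable: it is strongly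
connected and one can assign a positive multiplicity to each edge so that at every vertex the
total multiplicity of in-edges equals that of the out-edges and both are at most `k`. -/
def Eulerianizable {V : Type*} [Fintype V] (A : V → V → Prop) (S : Set V) (k : ℕ) : Prop :=
  StrongOn A S ∧ ∃ m : V → V → ℕ,
    (∀ u v, A u v → 1 ≤ m u v) ∧ (∀ u v, ¬ A u v → m u v = 0) ∧
    ∀ v ∈ S, (∑ u, m u v) = (∑ u, m v u) ∧ (∑ u, m v u) ≤ k

/-- A representation of the graph `G` in the digraph on `V` with adjacency `A`:
collections of pairwise vertex-disjoint strongly connected subdigraphs indexed by the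
vertices of `G`, and of pairwise vertex-disjoint `2`-eulerianizable subdigraphs indexed
by the edges of `G`, such that the subdigraph of each edge shares a vertex with the
subdigraph of each of its two ends. -/
structure DigraphRep (V : Type*) [Fintype V] (A : V → V → Prop)
    {W : Type*} (G : SimpleGraph W) where
  vS : W → Set V
  vA : W → V → V → Prop
  eS : Sym2 W → Set V
  eA : Sym2 W → V → V → Prop
  vSub : ∀ w, IsSubdigraph A (vS w) (vA w)
  vNonempty : ∀ w, (vS w).Nonempty
  vStrong : ∀ w, StrongOn (vA w) (vS w)
  vDisj : ∀ w w', w ≠ w' → Disjoint (vS w) (vS w')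
  eSub : ∀ e ∈ G.edgeSet, IsSubdigraph A (eS e) (eA e)
  eNonempty : ∀ e ∈ G.edgeSet, (eS e).Nonempty
  eEul : ∀ e ∈ G.edgeSet, Eulerianizable (eA e) (eS e) 2
  eDisj : ∀ e ∈ G.edgeSet, ∀ e' ∈ G.edgeSet, e ≠ e' → Disjoint (eS e) (eS e')
  meets : ∀ e ∈ G.edgeSet, ∀ w ∈ e, (eS e ∩ vS w).Nonempty

/-- The representation is faithful: the subdigraph of each edge is vertex-disjoint from
the subdigraph of every vertex of `G` that is not an end of that edge. -/
def DigraphRep.Faithful {V W : Type*} [Fintype V] {A : V → V → Prop}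
    {G : SimpleGraph W} (R : DigraphRep V A G) : Prop :=
  ∀ e ∈ G.edgeSet, ∀ w, w ∉ e → Disjoint (R.eS e) (R.vS w)

section Reachability
variable {V : Type} {A : V → V → Prop}

/-- Reachability by directed walks staying inside `C`. -/
def ReachIn (A : V → V → Prop) (C : Set V) : V → V → Prop :=
  Relation.ReflTransGen (fun a b => A a b ∧ a ∈ C ∧ b ∈ C)

lemma ReachIn.mono {C C' : Set V} (hC : C ⊆ C') {u v : V} (h : ReachIn A C u v) :
    ReachIn A C' u v :=
  Relation.ReflTransGen.mono (fun _ _ hab => ⟨hab.1, hC hab.2.1, hC hab.2.2⟩) _ _ h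

lemma exists_dipath_of_reachIn {C : Set V} {u v : V} (hv : v ∈ C) (h : ReachIn A C u v) :
    ∃ l : List V, DipathIn A C l ∧ l.head? = some u ∧ l.getLast? = some v := by
  induction h using Relation.ReflTransGen.head_induction_on with
  | refl =>
    exact ⟨[v], ⟨⟨by simp, by simp, List.isChain_singleton v⟩, by simpa using hv⟩, by simp, by simp⟩
  | @head a b hab _ ih =>
    obtain ⟨l, ⟨⟨hne, hnd, hch⟩, hmem⟩, hhd, hlast⟩ := ih
    by_cases ha : a ∈ l
    · obtain ⟨s, t, rfl⟩ := List.append_of_mem ha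
      refine ⟨a :: t, ⟨⟨by simp, ?_, ?_⟩, ?_⟩, by simp, ?_⟩
      · exact (List.nodup_append.1 hnd).2.1
      · exact (List.isChain_append.1 hch).2.1
      · intro w hw
        exact hmem w (by simp at hw ⊢; tauto)
      · simpa [List.getLast?_append] using hlast
    · refine ⟨a :: l, ⟨⟨by simp, by simp [ha, hnd], ?_⟩, ?_⟩, by simp, ?_⟩
      · exact List.isChain_cons.2 ⟨fun y hy => by
          rw [hhd] at hy
          simp at hy
          exact hy ▸ hab.1, hch⟩
      · intro w hw
        rcases List.mem_cons.1 hw with rfl | hw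
        · exact hab.2.1
        · exact hmem w hw
      · rw [List.getLast?_cons, hlast]; rfl

lemma reachIn_of_isChain {C : Set V} {l : List V} {u v : V} (hl : l.IsChain A)
    (hC : ∀ w ∈ l, w ∈ C) (hu : l.head? = some u) (hv : l.getLast? = some v) :
    ReachIn A C u v := by
  induction l generalizing u with
  | nil => simp at hu
  | cons a l ih =>
    simp at hu
    subst hu
    cases l with
    | nil =>
      simp at hv
      subst hv
      exact Relation.ReflTransGen.refl
    | cons b l =>
      rw [List.isChain_cons_cons] at hl
      refine Relation.ReflTransGen.head ⟨hl.1, hC _ (by simp), hC _ (by simp)⟩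
        (ih hl.2 (fun w hw => hC w (List.mem_cons_of_mem _ hw)) (by simp) ?_)
      simpa [List.getLast?_cons] using hv

lemma strongOn_iff_reachIn {C : Set V} :
    StrongOn A C ↔ ∀ u ∈ C, ∀ v ∈ C, ReachIn A C u v := by
  refine ⟨fun h u hu v hv => ?_, fun h u hu v hv => exists_dipath_of_reachIn hv (h u hu v hv)⟩
  obtain ⟨l, hl, h1, h2⟩ := h u hu v hv
  exact reachIn_of_isChain hl.1.2.2 hl.2 h1 h2

lemma StrongOn.union {C C' : Set V} (h : StrongOn A C) (h' : StrongOn A C')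
    (hne : (C ∩ C').Nonempty) : StrongOn A (C ∪ C') := by
  obtain ⟨x, hx, hx'⟩ := hne
  rw [strongOn_iff_reachIn] at *
  have key : ∀ u ∈ C ∪ C', ReachIn A (C ∪ C') u x ∧ ReachIn A (C ∪ C') x u := by
    rintro u (hu | hu)
    · exact ⟨(h u hu x hx).mono Set.subset_union_left, (h x hx u hu).mono Set.subset_union_left⟩
    · exact ⟨(h' u hu x hx').mono Set.subset_union_right,
        (h' x hx' u hu).mono Set.subset_union_right⟩
  exact fun u hu v hv => (key u hu).1.trans (key v hv).2

lemma StrongOn.exists_component [Finite V] {C W : Set V} (h : StrongOn A C) (hne : C.Nonempty)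
    (hCW : C ⊆ W) : ∃ C', IsStrongComponent A W C' ∧ C ⊆ C' := by
  obtain ⟨C', hCC', hmax⟩ := (Set.toFinite {T : Set V | T ⊆ W ∧ StrongOn A T}).exists_le_maximal
    (a := C) ⟨hCW, h⟩
  exact ⟨C', ⟨hmax.prop.1, hne.mono hCC', hmax.prop.2, fun T hT hTW hTs =>
    (hmax.eq_of_le ⟨hTW, hTs⟩ hT).symm⟩, hCC'⟩

end Reachability

section Circulations
open Classical Finset

variable {V : Type} {A : V → V → Prop} {k : ℕ} {m : V → V → ℕ}

/-- `W` is connected, disregarding directions, by edges of positive weight. -/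
def Conn (m : V → V → ℕ) (W : Set V) : Prop :=
  ∀ U : Set V, (W ∩ U).Nonempty → (W \ U).Nonempty →
    ∃ u ∈ W ∩ U, ∃ v ∈ W \ U, 0 < m u v ∨ 0 < m v u

lemma Conn.mono {m' : V → V → ℕ} {W : Set V} (h : Conn m W) (hm : ∀ u v, m u v ≤ m' u v) :
    Conn m' W := by
  intro U h1 h2
  obtain ⟨u, hu, v, hv, h3⟩ := h U h1 h2
  exact ⟨u, hu, v, hv, h3.imp (fun h => h.trans_le (hm _ _)) (fun h => h.trans_le (hm _ _))⟩

lemma Conn.union {W W' : Set V} (h : Conn m W) (h' : Conn m W') (hne : (W ∩ W').Nonempty) :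
    Conn m (W ∪ W') := by
  obtain ⟨x, hx, hx'⟩ := hne
  have aux : ∀ (T T' : Set V), Conn m T → Conn m T' → x ∈ T → x ∈ T' → ∀ U : Set V,
      (T ∩ U).Nonempty → (T' \ U).Nonempty →
      ∃ u ∈ (T ∪ T') ∩ U, ∃ v ∈ (T ∪ T') \ U, 0 < m u v ∨ 0 < m v u := by
    intro T T' hT hT' hxT hxT' U h1 h2
    by_cases hxU : x ∈ U
    · obtain ⟨u, hu, v, hv, h3⟩ := hT' U ⟨x, hxT', hxU⟩ h2
      exact ⟨u, ⟨Or.inr hu.1, hu.2⟩, v, ⟨Or.inr hv.1, hv.2⟩, h3⟩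
    · obtain ⟨u, hu, v, hv, h3⟩ := hT U h1 ⟨x, hxT, hxU⟩
      exact ⟨u, ⟨Or.inl hu.1, hu.2⟩, v, ⟨Or.inl hv.1, hv.2⟩, h3⟩
  rintro U ⟨a, ha, haU⟩ ⟨b, hb, hbU⟩
  rcases ha with ha | ha <;> rcases hb with hb | hb
  · obtain ⟨u, hu, v, hv, h3⟩ := h U ⟨a, ha, haU⟩ ⟨b, hb, hbU⟩
    exact ⟨u, ⟨Or.inl hu.1, hu.2⟩, v, ⟨Or.inl hv.1, hv.2⟩, h3⟩
  · exact aux W W' h h' hx hx' U ⟨a, ha, haU⟩ ⟨b, hb, hbU⟩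
  · simpa only [Set.union_comm] using aux W' W h' h hx' hx U ⟨a, ha, haU⟩ ⟨b, hb, hbU⟩
  · obtain ⟨u, hu, v, hv, h3⟩ := h' U ⟨a, ha, haU⟩ ⟨b, hb, hbU⟩
    exact ⟨u, ⟨Or.inr hu.1, hu.2⟩, v, ⟨Or.inr hv.1, hv.2⟩, h3⟩

lemma Conn.subset_of_closed {W S : Set V} (h : Conn m W) (hne : (W ∩ S).Nonempty)
    (hS : ∀ u v, 0 < m u v → (u ∈ S ↔ v ∈ S)) : W ⊆ S := by
  by_contra hW
  obtain ⟨u, hu, v, hv, h3⟩ := h S hne (Set.sdiff_nonempty.2 hW)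
  rcases h3 with h3 | h3
  · exact hv.2 ((hS _ _ h3).1 hu.2)
  · exact hv.2 ((hS _ _ h3).2 hu.2)

variable [Fintype V]

/-- An integer circulation on the edges of `A` with at most `k` units through each vertex. -/
structure Circ (A : V → V → Prop) (k : ℕ) (m : V → V → ℕ) : Prop where
  supp : ∀ u v, 0 < m u v → A u v
  bal : ∀ v, ∑ u, m u v = ∑ u, m v u
  le : ∀ v, ∑ u, m v u ≤ k

lemma Circ.add {k' : ℕ} {m' : V → V → ℕ} (h : Circ A k m) (h' : Circ A k' m') :
    Circ A (k + k') (fun u v => m u v + m' u v) where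
  supp u v huv := by
    rcases Nat.eq_zero_or_pos (m u v) with h0 | h0
    · exact h'.supp u v (by omega)
    · exact h.supp u v h0
  bal v := by simp only [sum_add_distrib, h.bal v, h'.bal v]
  le v := by
    simp only [sum_add_distrib]
    exact add_le_add (h.le v) (h'.le v)

lemma Circ.cut (h : Circ A k m) (U : Finset V) :
    ∑ u ∈ U, ∑ v ∈ Uᶜ, m u v = ∑ u ∈ Uᶜ, ∑ v ∈ U, m u v := by
  have h1 : ∑ u ∈ U, ∑ v, m u v = ∑ u ∈ U, ∑ v, m v u :=
    sum_congr rfl fun u _ => (h.bal u).symm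
  simp only [← sum_add_sum_compl U, sum_add_distrib] at h1
  rw [sum_comm (s := U) (t := U)] at h1
  rw [sum_comm (s := Uᶜ) (t := U)]
  omega

lemma Circ.reach_symm (h : Circ A k m) {u v : V}
    (huv : Relation.ReflTransGen (fun a b => 0 < m a b) u v) :
    Relation.ReflTransGen (fun a b => 0 < m a b) v u := by
  set U : Finset V := univ.filter fun x => Relation.ReflTransGen (fun a b => 0 < m a b) v x
  have h0 : ∑ a ∈ Uᶜ, ∑ b ∈ U, m a b = 0 := by
    rw [← h.cut U]
    refine sum_eq_zero fun a ha => sum_eq_zero fun b hb => ?_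
    by_contra hab
    simp only [U, mem_compl, mem_filter, mem_univ, true_and] at ha hb
    exact hb (ha.tail (Nat.pos_of_ne_zero hab))
  induction huv using Relation.ReflTransGen.head_induction_on with
  | refl => exact .refl
  | @head a b hab _ ih =>
    by_contra ha
    have h1 := sum_eq_zero_iff.1 h0 a (by simp [U, ha])
    have h2 := sum_eq_zero_iff.1 h1 b (by simp [U, ih])
    omega

lemma eulerianizable_of_circ {S : Set V} (h : Circ A k m)
    (hS : ∀ u v, 0 < m u v → u ∈ S ∧ v ∈ S) (hc : Conn m S) :
    Eulerianizable (fun u v => 0 < m u v) S k := by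
  refine ⟨strongOn_iff_reachIn.2 fun u hu v hv => ?_, m, fun _ _ h => h,
    fun _ _ h => by omega, fun v _ => ⟨h.bal v, h.le v⟩⟩
  have hR : Relation.ReflTransGen (fun a b => 0 < m a b) u v := by
    have := hc.subset_of_closed (S := {x | Relation.ReflTransGen (fun a b => 0 < m a b) u x})
      ⟨u, hu, .refl⟩ (fun a b hab => ⟨fun ha => ha.tail hab,
        fun hb => hb.trans (h.reach_symm (.single hab))⟩)
    exact this hv
  exact Relation.ReflTransGen.mono (fun a b hab => ⟨hab, hS a b hab⟩) _ _ hR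

variable {M n : ℕ} {W : Fin M → Set V}

lemma Circ.card_split_le (h : Circ A 4 m) (hW : ∀ i, Conn m (W i))
    (hov : ∀ v, #{i | v ∈ W i} ≤ 4) {Z : Finset V} {U : Set V} (hZU : ∀ z ∈ Z, z ∉ U)
    (hU : ∀ x w, w ∈ U → x ∉ Z → 0 < m x w → x ∈ U) :
    #{i | ¬ W i ⊆ U ∧ ¬ W i ⊆ (↑Z ∪ U)ᶜ} ≤ 20 * #Z := by
  set T : Finset V := {u | u ∈ U ∧ ∃ v, v ∉ U ∧ 0 < m u v}
  set F : Finset V := {u | u ∈ U}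
  have hT : #T ≤ 4 * #Z := by
    calc #T = ∑ u ∈ T, 1 := by simp
      _ ≤ ∑ u ∈ T, ∑ v ∈ Fᶜ, m u v := by
        refine sum_le_sum fun u hu => ?_
        simp only [T, mem_filter, mem_univ, true_and] at hu
        obtain ⟨_, v, hv, huv⟩ := hu
        exact le_trans huv (single_le_sum (f := fun v => m u v) (fun _ _ => Nat.zero_le _)
          (by simpa [F] using hv))
      _ ≤ ∑ u ∈ F, ∑ v ∈ Fᶜ, m u v :=
        sum_le_sum_of_subset fun u hu => by
          simp only [T, F, mem_filter, mem_univ, true_and] at hu ⊢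
          exact hu.1
      _ = ∑ u ∈ Fᶜ, ∑ v ∈ F, m u v := h.cut F
      _ = ∑ u ∈ Z, ∑ v ∈ F, m u v := by
        symm
        refine sum_subset (fun z hz => by simpa [F] using hZU z hz) fun x hx hxZ => ?_
        refine sum_eq_zero fun w hw => ?_
        by_contra hne
        simp only [F, mem_compl, mem_filter, mem_univ, true_and] at hx hw
        exact hx (hU x w hw hxZ (Nat.pos_of_ne_zero hne))
      _ ≤ ∑ u ∈ Z, 4 := sum_le_sum fun u _ =>
        (sum_le_sum_of_subset (subset_univ F)).trans (h.le u)
      _ = 4 * #Z := by simp [mul_comm]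
  calc #{i | ¬ W i ⊆ U ∧ ¬ W i ⊆ (↑Z ∪ U)ᶜ}
      ≤ #((Z ∪ T).biUnion fun v => ({i | v ∈ W i} : Finset (Fin M))) := by
        refine card_le_card fun i hi => ?_
        simp only [mem_filter, mem_univ, true_and] at hi
        by_contra hcon
        simp only [mem_biUnion, mem_filter, mem_univ, true_and, not_exists, not_and,
          Finset.mem_union] at hcon
        have hdis : ¬ (W i ∩ U).Nonempty := by
          intro hne
          obtain ⟨u, hu, v, hv, huv⟩ := hW i U hne (Set.sdiff_nonempty.2 hi.1)
          rcases huv with huv | huv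
          · exact hcon u (Or.inr (by
              simp only [T, mem_filter, mem_univ, true_and]
              exact ⟨hu.2, v, hv.2, huv⟩)) hu.1
          · exact hv.2 (hU v u hu.2 (fun hvZ => hcon v (Or.inl hvZ) hv.1) huv)
        refine hi.2 fun x hx => ?_
        rintro (hxZ | hxU)
        · exact hcon x (Or.inl hxZ) hx
        · exact hdis ⟨x, hx, hxU⟩
    _ ≤ #(Z ∪ T) * 4 := card_biUnion_le_card_mul _ _ _ fun v _ => hov v
    _ ≤ 20 * #Z := by
        have := card_union_le Z T
        omega

lemma Circ.split_dichotomy (h : Circ A 4 m) (hW : ∀ i, Conn m (W i))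
    (hov : ∀ v, #{i | v ∈ W i} ≤ 4) (hint : ∀ i j, (W i ∩ W j).Nonempty)
    {Z : Finset V} (hZ : #Z ≤ n) {U : Set V} (hZU : ∀ z ∈ Z, z ∉ U)
    (hU : ∀ x w, w ∈ U → x ∉ Z → 0 < m x w → x ∈ U) :
    M ≤ #{i | W i ⊆ U} + 20 * n ∨ M ≤ #{i | W i ⊆ (↑Z ∪ U)ᶜ} + 20 * n := by
  have h1 := h.card_split_le hW hov hZU hU
  have h2 : M ≤ #{i | W i ⊆ U} + #{i | W i ⊆ (↑Z ∪ U)ᶜ} +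
      #{i | ¬ W i ⊆ U ∧ ¬ W i ⊆ (↑Z ∪ U)ᶜ} := by
    calc M = #(univ : Finset (Fin M)) := by simp
      _ ≤ #((({i | W i ⊆ U} : Finset (Fin M)) ∪ ({i | W i ⊆ (↑Z ∪ U)ᶜ} : Finset (Fin M))) ∪
          ({i | ¬ W i ⊆ U ∧ ¬ W i ⊆ (↑Z ∪ U)ᶜ} : Finset (Fin M))) := by
        refine card_le_card fun i _ => ?_
        simp only [Finset.mem_union, mem_filter, mem_univ, true_and]
        tauto
      _ ≤ _ := (card_union_le _ _).trans (Nat.add_le_add_right (card_union_le _ _) _)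
  rcases Nat.eq_zero_or_pos #{i | W i ⊆ U} with h3 | h3
  · right
    omega
  · left
    rcases Nat.eq_zero_or_pos #{i | W i ⊆ (↑Z ∪ U)ᶜ} with h4 | h4
    · omega
    · exfalso
      obtain ⟨i, hi⟩ := card_pos.1 h3
      obtain ⟨j, hj⟩ := card_pos.1 h4
      simp only [mem_filter, mem_univ, true_and] at hi hj
      obtain ⟨x, hx, hx'⟩ := hint i j
      exact hj hx' (Or.inr (hi hx))

lemma Circ.exists_majority_component (h : Circ A 4 m) (hW : ∀ i, Conn m (W i))
    (hov : ∀ v, #{i | v ∈ W i} ≤ 4) (hint : ∀ i j, (W i ∩ W j).Nonempty)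
    (hM : 80 * n < M) {S : Set V} (hS : ∀ u v, 0 < m u v → u ∈ S ∧ v ∈ S)
    (hWS : ∀ i, W i ⊆ S) {Z : Finset V} (hZ : #Z ≤ n) :
    ∃ C, IsStrongComponent (fun u v => 0 < m u v) (S \ ↑Z) C ∧ M < 2 * #{i | W i ⊆ C} := by
  set E : V → V → Prop := fun u v => 0 < m u v
  set 𝒰 : Set (Set V) := {U | U ⊆ S \ ↑Z ∧ (∀ x w, w ∈ U → x ∉ Z → 0 < m x w → x ∈ U) ∧
    M ≤ #{i | W i ⊆ U} + 20 * n}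
  have hSZ : S \ ↑Z ∈ 𝒰 := by
    have hcl : ∀ x w, w ∈ S \ (↑Z : Set V) → x ∉ Z → 0 < m x w → x ∈ S \ (↑Z : Set V) :=
      fun x w _ hx hxw => ⟨(hS x w hxw).1, hx⟩
    refine ⟨le_rfl, hcl, ?_⟩
    rcases h.split_dichotomy hW hov hint hZ (fun z hz hz' => hz'.2 hz) hcl with h1 | h1
    · exact h1
    · exfalso
      obtain ⟨j, hj⟩ := card_pos.1 (show 0 < #{i | W i ⊆ (↑Z ∪ S \ (↑Z : Set V))ᶜ} by omega)
      simp only [mem_filter, mem_univ, true_and] at hj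
      obtain ⟨x, hx, _⟩ := hint j j
      refine hj hx ?_
      by_cases hxZ : x ∈ (↑Z : Set V)
      · exact Or.inl hxZ
      · exact Or.inr ⟨hWS j hx, hxZ⟩
  obtain ⟨U, hUmin⟩ := (Set.toFinite 𝒰).exists_minimal ⟨_, hSZ⟩
  obtain ⟨hUS, hUcl, hUM⟩ := hUmin.prop
  have hUne : U.Nonempty := by
    obtain ⟨j, hj⟩ := card_pos.1 (show 0 < #{i | W i ⊆ U} by omega)
    simp only [mem_filter, mem_univ, true_and] at hj
    exact (hint j j).mono fun x hx => hj hx.1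
  obtain ⟨v, hvU, hvmin⟩ := Set.exists_min_image U (fun v => {w | ReachIn E U v w}.ncard)
    (Set.toFinite U) hUne
  set R : Set V := {w | ReachIn E U v w}
  have hvR : v ∈ R := Relation.ReflTransGen.refl
  have hRU : R ⊆ U := by
    intro w hw
    rcases Relation.ReflTransGen.cases_tail hw with rfl | ⟨_, _, hb⟩
    · exact hvU
    · exact hb.2.2
  have hstay : ∀ a b, a ∈ R → ReachIn E U a b → ReachIn E R a b := by
    intro a b ha hab
    induction hab with
    | refl => exact .refl
    | @tail b c hab hbc ih =>
      have hb : b ∈ R := Relation.ReflTransGen.trans ha hab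
      exact ih.tail ⟨hbc.1, hb, Relation.ReflTransGen.tail hb hbc⟩
  have hRs : StrongOn E R := by
    rw [strongOn_iff_reachIn]
    intro a ha b hb
    refine hstay a b ha ?_
    have hsub : {w | ReachIn E U a w} ⊆ R := fun w hw => Relation.ReflTransGen.trans ha hw
    have heq := Set.eq_of_subset_of_ncard_le hsub (hvmin a (hRU ha)) (Set.toFinite R)
    have hb' : b ∈ {w | ReachIn E U a w} := heq.symm ▸ hb
    exact hb'
  have hM2 : M ≤ #{i | W i ⊆ (↑Z ∪ U \ R)ᶜ} + 20 * n := by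
    have hcl : ∀ x w, w ∈ U \ R → x ∉ Z → 0 < m x w → x ∈ U \ R := by
      intro x w hw hx hxw
      have hxU := hUcl x w hw.1 hx hxw
      exact ⟨hxU, fun hxR => hw.2 (Relation.ReflTransGen.tail hxR ⟨hxw, hxU, hw.1⟩)⟩
    rcases h.split_dichotomy hW hov hint hZ (fun z hz hz' => (hUS hz'.1).2 hz) hcl with h1 | h1
    · exfalso
      exact (hUmin.le_of_le ⟨Set.sdiff_subset.trans hUS, hcl, h1⟩ Set.sdiff_subset hvU).2 hvR
    · exact h1
  have hRM : M ≤ #{i | W i ⊆ R} + 40 * n := by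
    have h1 : ({i | W i ⊆ U} : Finset (Fin M)) ∩ ({i | W i ⊆ (↑Z ∪ U \ R)ᶜ} : Finset (Fin M)) ⊆
        ({i | W i ⊆ R} : Finset (Fin M)) := by
      intro i hi
      simp only [Finset.mem_inter, mem_filter, mem_univ, true_and] at hi ⊢
      intro x hx
      by_contra hxR
      exact hi.2 hx (Or.inr ⟨hi.1 hx, hxR⟩)
    have h2 := card_le_card h1
    have h3 := card_union_add_card_inter ({i | W i ⊆ U} : Finset (Fin M))
      ({i | W i ⊆ (↑Z ∪ U \ R)ᶜ} : Finset (Fin M))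
    have h4 := card_le_univ (({i | W i ⊆ U} : Finset (Fin M)) ∪
      ({i | W i ⊆ (↑Z ∪ U \ R)ᶜ} : Finset (Fin M)))
    rw [Fintype.card_fin] at h4
    omega
  obtain ⟨C, hC, hRC⟩ := hRs.exists_component ⟨v, hvR⟩ (hRU.trans hUS)
  refine ⟨C, hC, ?_⟩
  have h5 : #{i | W i ⊆ R} ≤ #{i | W i ⊆ C} := card_le_card fun i hi => by
    simp only [mem_filter, mem_univ, true_and] at hi ⊢
    exact hi.trans hRC
  omega

/-- Some `4`-eulerianizable subdigraph has a haven of order at least `n`. -/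
def HasEulerianHaven (A : V → V → Prop) (n : ℕ) : Prop :=
  ∃ (S : Set V) (A' : V → V → Prop), IsSubdigraph A S A' ∧ Eulerianizable A' S 4 ∧
    ∃ w, n ≤ w ∧ HasHavenOn A' S w

lemma Circ.hasEulerianHaven_of_conn (h : Circ A 4 m) (hW : ∀ i, Conn m (W i))
    (hov : ∀ v, #{i | v ∈ W i} ≤ 4) (hint : ∀ i j, (W i ∩ W j).Nonempty)
    (hM : 80 * n < M) {S : Set V} (hS : ∀ u v, 0 < m u v → u ∈ S ∧ v ∈ S)
    (hWS : ∀ i, W i ⊆ S) (hc : Conn m S) : HasEulerianHaven A n := by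
  refine ⟨S, fun u v => 0 < m u v, fun u v huv => ⟨h.supp u v huv, hS u v huv⟩,
    eulerianizable_of_circ h hS hc, n, le_rfl, ?_⟩
  have key : ∀ Z : Finset V, ∃ C, #Z < n →
      IsStrongComponent (fun u v => 0 < m u v) (S \ ↑Z) C ∧ M < 2 * #{i | W i ⊆ C} := by
    intro Z
    by_cases hZ : #Z < n
    · obtain ⟨C, hC⟩ := h.exists_majority_component hW hov hint hM hS hWS hZ.le
      exact ⟨C, fun _ => hC⟩
    · exact ⟨∅, fun h => absurd h hZ⟩
  choose B hB using key
  refine ⟨B, fun Z hZS hZ => ⟨(hB Z hZ).1, fun Z' hZ' => ?_⟩⟩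
  have hZ'n : #Z' < n := (card_le_card hZ').trans_lt hZ
  obtain ⟨⟨hC1, hC2, hC3, hC4⟩, hC5⟩ := hB Z hZ
  obtain ⟨⟨hC1', hC2', hC3', hC4'⟩, hC5'⟩ := hB Z' hZ'n
  have hne :
      (({i | W i ⊆ B Z} : Finset (Fin M)) ∩ ({i | W i ⊆ B Z'} : Finset (Fin M))).Nonempty := by
    rw [← card_pos]
    have h3 := card_union_add_card_inter ({i | W i ⊆ B Z} : Finset (Fin M))
      ({i | W i ⊆ B Z'} : Finset (Fin M))
    have h4 := card_le_univ (({i | W i ⊆ B Z} : Finset (Fin M)) ∪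
      ({i | W i ⊆ B Z'} : Finset (Fin M)))
    rw [Fintype.card_fin] at h4
    omega
  obtain ⟨i, hi⟩ := hne
  simp only [Finset.mem_inter, mem_filter, mem_univ, true_and] at hi
  have hmeet : (B Z' ∩ B Z).Nonempty := (hint i i).mono fun x hx => ⟨hi.2 hx.1, hi.1 hx.1⟩
  have hun := hC4' (B Z' ∪ B Z) Set.subset_union_left
    (Set.union_subset hC1' (hC1.trans (Set.sdiff_subset_sdiff_right (by exact_mod_cast hZ'))))
    (hC3'.union hC3 hmeet)
  exact hun ▸ Set.subset_union_right

/-- Many pairwise intersecting connected sets of bounded overlap in a circulation force a haven. -/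
lemma Circ.hasEulerianHaven (h : Circ A 4 m) (hW : ∀ i, Conn m (W i))
    (hov : ∀ v, #{i | v ∈ W i} ≤ 4) (hint : ∀ i j, (W i ∩ W j).Nonempty)
    (hM : 80 * n < M) : HasEulerianHaven A n := by
  obtain ⟨w, hw, -⟩ := hint ⟨0, by omega⟩ ⟨0, by omega⟩
  set E : V → V → Prop := fun a b => 0 < m a b
  set S : Set V := {x | Relation.ReflTransGen E w x}
  have hcl : ∀ u v, 0 < m u v → (u ∈ S ↔ v ∈ S) := fun a b hab =>
    ⟨fun ha => Relation.ReflTransGen.tail ha hab,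
      fun hb => Relation.ReflTransGen.trans hb (h.reach_symm (.single hab))⟩
  have h0 : W ⟨0, by omega⟩ ⊆ S := (hW _).subset_of_closed ⟨w, hw, Relation.ReflTransGen.refl⟩ hcl
  have hWS : ∀ i, W i ⊆ S := fun i => (hW i).subset_of_closed
    ((hint i ⟨0, by omega⟩).mono fun x hx => ⟨hx.1, h0 hx.2⟩) hcl
  have hr : ∀ u v, v ∈ S → (if u ∈ S then m u v else 0) = m u v := by
    intro u v hv
    split_ifs with hu
    · rfl
    · by_contra hne
      exact hu ((hcl u v (Nat.pos_of_ne_zero (Ne.symm hne))).2 hv)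
  have hmem : ∀ u v, 0 < (if u ∈ S then m u v else 0) → u ∈ S ∧ 0 < m u v := by
    intro u v huv
    split_ifs at huv with hu
    · exact ⟨hu, huv⟩
    · omega
  have hcirc : Circ A 4 (fun u v => if u ∈ S then m u v else 0) := by
    refine ⟨fun u v huv => h.supp u v (hmem u v huv).2, fun v => ?_, fun v => ?_⟩
    · by_cases hv : v ∈ S
      · simp only [hr _ _ hv, hv, if_true]
        exact h.bal v
      · simp only [hv, if_false, sum_const_zero]
        refine sum_eq_zero fun u _ => ?_
        by_contra hne
        obtain ⟨h1, h2⟩ := hmem u v (Nat.pos_of_ne_zero hne)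
        exact hv ((hcl u v h2).1 h1)
    · by_cases hv : v ∈ S
      · simpa only [hv, if_true] using h.le v
      · simp [hv]
  refine hcirc.hasEulerianHaven_of_conn (W := W) (S := S) ?_ hov hint hM
    (fun u v huv => ⟨(hmem u v huv).1, (hcl u v (hmem u v huv).2).1 (hmem u v huv).1⟩) hWS ?_
  · intro i U h1 h2
    obtain ⟨u, hu, v, hv, h3⟩ := hW i U h1 h2
    refine ⟨u, hu, v, hv, ?_⟩
    beta_reduce
    rwa [hr _ _ (hWS i hu.1), hr _ _ (hWS i hv.1)]
  · rintro U ⟨a, haS, haU⟩ ⟨b, hbS, hbU⟩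
    by_contra hcon
    push Not at hcon
    have hreach : Relation.ReflTransGen E a b := (h.reach_symm haS).trans hbS
    have : ∀ x, Relation.ReflTransGen E a x → x ∈ S ∧ x ∈ U := by
      intro x hx
      induction hx with
      | refl => exact ⟨haS, haU⟩
      | @tail y z _ hyz ih =>
        have hz : z ∈ S := (hcl y z hyz).1 ih.1
        refine ⟨hz, ?_⟩
        by_contra hzU
        have := (hcon y ih z ⟨hz, hzU⟩).1
        rw [hr _ _ hz] at this
        exact absurd hyz (by simpa [E] using this)
    exact hbU (this b hreach).2

end Circulations

section Ramsey
open Finset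

lemma exists_endHomogeneous (C : Type) [Fintype C] [DecidableEq C] (q : ℕ) :
    ∃ M : ℕ, ∀ (α : Type) [LinearOrder α] (s : Finset α) (c : α → α → C), M ≤ #s →
      ∃ f : Fin q → α, StrictMono f ∧ (∀ i, f i ∈ s) ∧
        ∃ g : Fin q → C, ∀ i j, i < j → c (f i) (f j) = g i := by
  induction q with
  | zero =>
    exact ⟨0, fun α _ s c _ => ⟨Fin.elim0, fun i => i.elim0, fun i => i.elim0, Fin.elim0,
      fun i => i.elim0⟩⟩
  | succ q ih =>
    obtain ⟨M, hM⟩ := ih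
    refine ⟨1 + Fintype.card C * M, fun α _ s c hs => ?_⟩
    have hne : s.Nonempty := card_pos.1 (by omega)
    set a := s.min' hne
    have hcard : #(s.erase a) = #s - 1 := card_erase_of_mem (s.min'_mem hne)
    obtain ⟨col, -, hcol⟩ := exists_le_card_fiber_of_mul_le_card_of_maps_to
      (s := s.erase a) (t := (univ : Finset C)) (f := fun x => c a x) (n := M)
      (fun _ _ => mem_univ _) ⟨c a a, mem_univ _⟩ (by rw [card_univ]; omega)
    obtain ⟨f, hf, hfs, g, hg⟩ := hM α _ c hcol
    have hf' : ∀ i, f i ∈ s.erase a ∧ c a (f i) = col := fun i => by simpa using hfs i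
    have hlt : ∀ i, a < f i := fun i =>
      lt_of_le_of_ne (s.min'_le _ (mem_of_mem_erase (hf' i).1)) (ne_of_mem_erase (hf' i).1).symm
    refine ⟨Fin.cons a f, ?_, ?_, Fin.cons col g, ?_⟩
    · intro i j hij
      induction i using Fin.cases with
      | zero =>
        induction j using Fin.cases with
        | zero => exact absurd hij (lt_irrefl _)
        | succ j => simpa using hlt j
      | succ i =>
        induction j using Fin.cases with
        | zero => exact absurd hij (Fin.not_lt_zero _)
        | succ j => simpa using hf (Fin.succ_lt_succ_iff.1 hij)
    · intro i
      induction i using Fin.cases with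
      | zero => simpa using s.min'_mem hne
      | succ i => simpa using mem_of_mem_erase (hf' i).1
    · intro i j hij
      induction i using Fin.cases with
      | zero =>
        induction j using Fin.cases with
        | zero => exact absurd hij (lt_irrefl _)
        | succ j => simpa using (hf' j).2
      | succ i =>
        induction j using Fin.cases with
        | zero => exact absurd hij (Fin.not_lt_zero _)
        | succ j => simpa using hg i j (Fin.succ_lt_succ_iff.1 hij)

/-- Ramsey's theorem for pairs and finitely many colours. -/
lemma exists_homogeneous (C : Type) [Finite C] [Nonempty C] (q : ℕ) :
    ∃ M : ℕ, ∀ c : Fin M → Fin M → C, ∃ f : Fin q → Fin M, StrictMono f ∧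
      ∃ col : C, ∀ i j, i < j → c (f i) (f j) = col := by
  classical
  have := Fintype.ofFinite C
  obtain ⟨M, hM⟩ := exists_endHomogeneous C (Fintype.card C * q)
  refine ⟨M, fun c => ?_⟩
  obtain ⟨f, hf, -, g, hg⟩ := hM (Fin M) univ c (by simp)
  obtain ⟨col, -, hcol⟩ := exists_le_card_fiber_of_mul_le_card_of_maps_to
      (s := (univ : Finset (Fin (Fintype.card C * q)))) (t := (univ : Finset C)) (f := g) (n := q)
      (fun _ _ => mem_univ _) univ_nonempty (by simp)
  obtain ⟨t, ht, htq⟩ := exists_subset_card_eq hcol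
  refine ⟨fun i => f (t.orderEmbOfFin htq i), fun i j hij => hf (by simpa using hij), col,
    fun i j hij => ?_⟩
  rw [hg _ _ (by simpa using hij)]
  simpa using ht (t.orderEmbOfFin_mem htq i)

end Ramsey

section Families
open Classical Finset

variable {V : Type} [Fintype V] {A : V → V → Prop}

/-- A family of connected sets of overlap at most two inside a circulation of capacity two. -/
def Fam (A : V → V → Prop) {ι : Type} [Fintype ι] (p : ι → Set V) : Prop :=
  ∃ m, Circ A 2 m ∧ (∀ k, Conn m (p k)) ∧ ∀ v, #{k | v ∈ p k} ≤ 2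

lemma Fam.comp {ι κ : Type} [Fintype ι] [Fintype κ] {p : ι → Set V} (h : Fam A p)
    {g : κ → ι} (hg : Function.Injective g) : Fam A (fun k => p (g k)) := by
  obtain ⟨m, h1, h2, h3⟩ := h
  refine ⟨m, h1, fun k => h2 _, fun v => le_trans ?_ (h3 v)⟩
  exact card_le_card_of_injOn g (fun k hk => by simpa using hk) hg.injOn

/-- Two families all of whose members cross pairwise form a grid-like structure. -/
lemma Fam.hasEulerianHaven {n M : ℕ} {S R : Fin M → Set V} (hS : Fam A S) (hR : Fam A R)
    (hSR : ∀ i j, (S i ∩ R j).Nonempty) (hM : 80 * n < M) : HasEulerianHaven A n := by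
  obtain ⟨m, h1, h2, h3⟩ := hS
  obtain ⟨m', h1', h2', h3'⟩ := hR
  refine (h1.add h1').hasEulerianHaven (W := fun i => S i ∪ R i) (fun i => ?_) (fun v => ?_)
    (fun i j => ?_) hM
  · exact ((h2 i).mono fun _ _ => Nat.le_add_right _ _).union
      ((h2' i).mono fun _ _ => Nat.le_add_left _ _) (hSR i i)
  · refine (card_le_card (t := ({i | v ∈ S i} : Finset (Fin M)) ∪
      ({i | v ∈ R i} : Finset (Fin M))) fun i hi => by simpa using hi).trans ?_
    exact (card_union_le _ _).trans (Nat.add_le_add (h3 v) (h3' v))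
  · exact (hSR i j).mono (Set.inter_subset_inter Set.subset_union_left Set.subset_union_right)

/-- From many tuples of members of given families one can select many tuples that are
disjoint from each other. -/
lemma exists_disjoint_tuples (n : ℕ) (ι : Type) [Fintype ι] (q : ℕ) :
    ∃ M : ℕ, ∀ (V : Type) [Fintype V] (A : V → V → Prop) (p : ι → Fin M → Set V),
      (∀ α, Fam A (p α)) → HasEulerianHaven A n ∨
        ∃ f : Fin q → Fin M, Function.Injective f ∧
          ∀ i j, i ≠ j → ∀ α β, Disjoint (p α (f i)) (p β (f j)) := by
  set h := 80 * n + 1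
  obtain ⟨M, hM⟩ := exists_homogeneous (Set (ι × ι)) (max q (2 * h))
  refine ⟨M, fun V _ A p hp => ?_⟩
  obtain ⟨f, hf, col, hcol⟩ := hM fun k l => {x | ¬ Disjoint (p x.1 k) (p x.2 l)}
  rcases Set.eq_empty_or_nonempty col with rfl | ⟨⟨α, β⟩, hαβ⟩
  · right
    refine ⟨fun i => f (Fin.castLE (le_max_left _ _) i),
      hf.injective.comp (Fin.castLE_injective _), fun i j hij α β => ?_⟩
    have aux : ∀ i j : Fin (max q (2 * h)), i < j → ∀ α β, Disjoint (p α (f i)) (p β (f j)) := by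
      intro i j hij α β
      by_contra hcon
      have : (α, β) ∈ (∅ : Set (ι × ι)) := hcol i j hij ▸ hcon
      exact this
    rcases lt_or_gt_of_ne hij with hlt | hlt
    · exact aux _ _ (by simpa using hlt) α β
    · exact (aux _ _ (by simpa using hlt) β α).symm
  · left
    have hle : 2 * h ≤ max q (2 * h) := le_max_right _ _
    refine Fam.hasEulerianHaven (M := h) (n := n)
      ((hp α).comp (g := fun i : Fin h => f ⟨i, by omega⟩) ?_)
      ((hp β).comp (g := fun i : Fin h => f ⟨h + i, by omega⟩) ?_) ?_ (by omega)
    · intro i j hij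
      have := hf.injective hij
      simp only [Fin.mk.injEq] at this
      exact Fin.ext this
    · intro i j hij
      have := hf.injective hij
      simp only [Fin.mk.injEq] at this
      exact Fin.ext (by omega)
    · intro i j
      have hlt : (⟨i, by omega⟩ : Fin (max q (2 * h))) < ⟨h + j, by omega⟩ := by
        rw [Fin.mk_lt_mk]
        omega
      rw [← hcol _ _ hlt] at hαβ
      exact Set.not_disjoint_iff_nonempty_inter.1 hαβ

end Families

section Selection
open Classical Finset

lemma exists_injective_const {C : Type} [Fintype C] [Nonempty C] {T M : ℕ}
    (hM : Fintype.card C * T ≤ M) (g : Fin M → C) :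
    ∃ e : Fin T → Fin M, Function.Injective e ∧ ∃ col, ∀ i, g (e i) = col := by
  obtain ⟨col, -, hcol⟩ := exists_le_card_fiber_of_mul_le_card_of_maps_to
      (s := (univ : Finset (Fin M))) (t := (univ : Finset C)) (f := g) (n := T)
      (fun _ _ => mem_univ _) univ_nonempty (by simpa using hM)
  obtain ⟨t, ht, htq⟩ := exists_subset_card_eq hcol
  exact ⟨t.orderEmbOfFin htq, (t.orderEmbOfFin htq).injective, col,
    fun i => by simpa using ht (t.orderEmbOfFin_mem htq i)⟩

/-- Given a family of sets `S k` and for each `k` a large family of sets `r k a`, one can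
select indices `k` and, for each of them, some `a`, so that the sets `S k ∪ r k a` are disjoint. -/
lemma exists_disjoint_closures (n c : ℕ) :
    ∃ q T : ℕ, ∀ (V : Type) [Fintype V] (A : V → V → Prop) (S : Fin q → Set V)
      (r : Fin q → Fin T → Set V), Fam A S → (∀ k, Fam A (r k)) →
      HasEulerianHaven A n ∨ ∃ (k : Fin c → Fin q) (a : Fin c → Fin T),
        ∀ i j, i ≠ j → Disjoint (S (k i) ∪ r (k i) (a i)) (S (k j) ∪ r (k j) (a j)) := by
  set h := 80 * n + 1
  obtain ⟨T₁, hT₁⟩ := exists_disjoint_tuples n (Fin c) c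
  obtain ⟨q₀, hq₀⟩ := exists_homogeneous (Prop × Prop) (max c (h + 1))
  obtain ⟨q, hq⟩ := exists_disjoint_tuples n Unit q₀
  refine ⟨q, Fintype.card (Set (Fin q₀)) * max T₁ h, fun V _ A S r hS hr => ?_⟩
  rcases hq V A (fun _ => S) (fun _ => hS) with hE | ⟨f₀, hf₀, hdisj⟩
  · exact Or.inl hE
  have hpat : ∀ k : Fin q₀, ∃ e : Fin (max T₁ h) → Fin (Fintype.card (Set (Fin q₀)) * max T₁ h),
      Function.Injective e ∧ ∃ I : Set (Fin q₀), ∀ i,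
        {l | ¬ Disjoint (S (f₀ l)) (r (f₀ k) (e i))} = I := fun k =>
    exists_injective_const le_rfl fun a => {l | ¬ Disjoint (S (f₀ l)) (r (f₀ k) a)}
  choose e he I hI using hpat
  have hsparse : ∀ (k : Fin q₀) (l : Fin h → Fin q₀), Function.Injective l → (∀ i, l i ∈ I k) →
      HasEulerianHaven A n := by
    intro k l hl hlI
    refine Fam.hasEulerianHaven (M := h) (n := n) (hS.comp (hf₀.comp hl))
      ((hr (f₀ k)).comp ((he k).comp (Fin.castLE_injective (le_max_right T₁ h)))) ?_ (by omega)
    intro i j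
    have := hlI i
    rw [← hI k (Fin.castLE (le_max_right T₁ h) j)] at this
    exact Set.not_disjoint_iff_nonempty_inter.1 this
  obtain ⟨f, hf, col, hcol⟩ := hq₀ fun k l => (l ∈ I k, k ∈ I l)
  have hle : h + 1 ≤ max c (h + 1) := le_max_right _ _
  by_cases h1 : col.1
  · left
    refine hsparse (f ⟨0, by omega⟩) (fun i => f ⟨i + 1, by omega⟩) (fun i j hij => ?_) fun i => ?_
    · have := hf.injective hij
      simp only [Fin.mk.injEq] at this
      exact Fin.ext (by omega)
    · have := hcol ⟨0, by omega⟩ ⟨i + 1, by omega⟩ (by rw [Fin.mk_lt_mk]; omega)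
      rw [← this] at h1
      exact h1
  by_cases h2 : col.2
  · left
    refine hsparse (f ⟨h, by omega⟩) (fun i => f ⟨i, by omega⟩) (fun i j hij => ?_) fun i => ?_
    · have := hf.injective hij
      simp only [Fin.mk.injEq] at this
      exact Fin.ext (by omega)
    · have := hcol ⟨i, by omega⟩ ⟨h, by omega⟩ (by rw [Fin.mk_lt_mk]; omega)
      rw [← this] at h2
      exact h2
  have hI' : ∀ i j, i ≠ j → f j ∉ I (f i) := by
    intro i j hij hmem
    rcases lt_or_gt_of_ne hij with hlt | hlt
    · exact h1 (by rw [← hcol i j hlt]; exact hmem)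
    · exact h2 (by rw [← hcol j i hlt]; exact hmem)
  set g : Fin c → Fin q₀ := fun i => f (Fin.castLE (le_max_left _ _) i)
  have hg : Function.Injective g := hf.injective.comp (Fin.castLE_injective _)
  rcases hT₁ V A (fun i a => r (f₀ (g i)) (e (g i) (Fin.castLE (le_max_left _ _) a)))
    (fun i => (hr _).comp ((he _).comp (Fin.castLE_injective _))) with hE | ⟨f', hf', hdisj'⟩
  · exact Or.inl hE
  refine Or.inr ⟨fun i => f₀ (g i), fun i => e (g i) (Fin.castLE (le_max_left _ _) (f' i)),
    fun i j hij => ?_⟩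
  have hSr : ∀ i j, i ≠ j → ∀ a, Disjoint (S (f₀ (g j))) (r (f₀ (g i)) (e (g i) a)) := by
    intro i j hij a
    by_contra hcon
    refine hI' (Fin.castLE (le_max_left _ _) i) (Fin.castLE (le_max_left _ _) j)
      (fun h => hij (Fin.castLE_injective _ h)) ?_
    rw [← hI _ a]
    exact hcon
  rw [Set.disjoint_union_left, Set.disjoint_union_right, Set.disjoint_union_right]
  exact ⟨⟨hdisj _ _ (hg.ne hij) () (), hSr j i hij.symm _⟩, (hSr i j hij _).symm,
    hdisj' i j hij i j⟩

end Selection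

section Linkages
open Classical Finset

variable {V : Type}

/-- The unit flow along a list of vertices. -/
noncomputable def pathFlow : List V → V → V → ℕ
  | [], _, _ => 0
  | [_], _, _ => 0
  | a :: b :: l, u, v => (if u = a ∧ v = b then 1 else 0) + pathFlow (b :: l) u v

lemma pathFlow_supp {l : List V} {u v : V} (h : 0 < pathFlow l u v) : u ∈ l ∧ v ∈ l := by
  induction l with
  | nil => simp [pathFlow] at h
  | cons a l ih =>
    cases l with
    | nil => simp [pathFlow] at h
    | cons b l =>
      simp only [pathFlow] at h
      split_ifs at h with hab
      · simp [hab.1, hab.2]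
      · exact (ih (by omega)).imp (List.mem_cons_of_mem _) (List.mem_cons_of_mem _)

lemma adj_of_pathFlow_pos {A : V → V → Prop} {l : List V} (hl : l.IsChain A) {u v : V}
    (h : 0 < pathFlow l u v) : A u v := by
  induction l with
  | nil => simp [pathFlow] at h
  | cons a l ih =>
    cases l with
    | nil => simp [pathFlow] at h
    | cons b l =>
      rw [List.isChain_cons_cons] at hl
      simp only [pathFlow] at h
      split_ifs at h with hab
      · rw [hab.1, hab.2]
        exact hl.1
      · exact ih hl.2 (by omega)

lemma conn_singleton (m : V → V → ℕ) (a : V) : Conn m {a} := by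
  rintro U ⟨x, hx, hxU⟩ ⟨y, hy, hyU⟩
  simp only [Set.mem_singleton_iff] at hx hy
  exact absurd (hx ▸ hxU) (hy ▸ hyU)

lemma conn_pathFlow (l : List V) : Conn (pathFlow l) {v | v ∈ l} := by
  induction l with
  | nil => rintro U ⟨x, hx, -⟩; simp at hx
  | cons a l ih =>
    cases l with
    | nil => simpa using conn_singleton _ a
    | cons b l =>
      have hpair : Conn (pathFlow (a :: b :: l)) {a, b} := by
        have hpos : 0 < pathFlow (a :: b :: l) a b := by simp [pathFlow]
        rintro U ⟨x, hx, hxU⟩ ⟨y, hy, hyU⟩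
        refine ⟨x, ⟨hx, hxU⟩, y, ⟨hy, hyU⟩, ?_⟩
        rcases hx with rfl | rfl <;> rcases hy with rfl | rfl
        · exact absurd hxU hyU
        · exact Or.inl hpos
        · exact Or.inr hpos
        · exact absurd hxU hyU
      have := hpair.union (ih.mono fun u v => by simp [pathFlow]) ⟨b, by simp, by simp⟩
      convert this using 1
      ext x
      simp
      tauto

/-- The sum of the flows along the paths of a linkage. -/
noncomputable def linkFlow (S : Finset V) (P : V → List V) (u v : V) : ℕ :=
  ∑ a ∈ S, pathFlow (P a) u v

lemma pathFlow_le_linkFlow {S : Finset V} {P : V → List V} {a : V} (ha : a ∈ S) (u v : V) :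
    pathFlow (P a) u v ≤ linkFlow S P u v :=
  single_le_sum (f := fun a => pathFlow (P a) u v) (fun _ _ => Nat.zero_le _) ha

variable {A : V → V → Prop} {S T : Finset V} {P Q : V → List V} {τ τ' : V → V}

lemma IsLinkage.head_mem (h : IsLinkage A S T P τ) {a : V} (ha : a ∈ S) : a ∈ P a :=
  List.mem_of_mem_head? (h.1 a ha).2.2.1

lemma IsLinkage.last_mem (h : IsLinkage A S T P τ) {a : V} (ha : a ∈ S) : τ a ∈ P a :=
  List.mem_of_mem_getLast? (h.1 a ha).2.2.2

lemma IsLinkage.eq_of_mem (h : IsLinkage A S T P τ) {a b x : V} (ha : a ∈ S) (hb : b ∈ S)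
    (hxa : x ∈ P a) (hxb : x ∈ P b) : a = b := by
  by_contra hab
  exact h.2 a ha b hb hab x hxa hxb

lemma IsLinkage.injOn (h : IsLinkage A S T P τ) : Set.InjOn τ S := fun _ ha _ hb hab =>
  h.eq_of_mem ha hb (h.last_mem ha) (hab ▸ h.last_mem hb)

lemma IsLinkage.image_eq (h : IsLinkage A S T P τ) (hc : #S = #T) : S.image τ = T :=
  eq_of_subset_of_card_le (image_subset_iff.2 fun a ha => (h.1 a ha).1)
    (by rw [card_image_of_injOn h.injOn, hc])

lemma IsLinkage.restrict (h : IsLinkage A S T P τ) {S' : Finset V} (hS : S' ⊆ S) :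
    IsLinkage A S' (S'.image τ) P τ :=
  ⟨fun a ha => ⟨mem_image_of_mem τ ha, (h.1 a (hS ha)).2⟩,
    fun a ha b hb => h.2 a (hS ha) b (hS hb)⟩

lemma IsLinkage.sum_count_le (h : IsLinkage A S T P τ) (x : V) :
    ∑ a ∈ S, (P a).count x ≤ 1 := by
  by_cases hx : ∃ a ∈ S, x ∈ P a
  · obtain ⟨a, ha, hxa⟩ := hx
    rw [sum_eq_single_of_mem a ha fun b hb hba => List.count_eq_zero.2 fun hxb =>
      hba (h.eq_of_mem hb ha hxb hxa)]
    exact List.nodup_iff_count_le_one.1 (h.1 a ha).2.1.2.1 x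
  · push Not at hx
    rw [sum_eq_zero fun a ha => List.count_eq_zero.2 (hx a ha)]
    exact zero_le_one

variable [Fintype V]

lemma sum_pathFlow_out (l : List V) (u : V) :
    ∑ v, pathFlow l u v + (if l.getLast? = some u then 1 else 0) = l.count u := by
  induction l with
  | nil => simp [pathFlow]
  | cons a l ih =>
    cases l with
    | nil => simp [pathFlow, List.count_singleton]
    | cons b l =>
      rw [List.count_cons, ← ih, List.getLast?_cons_cons]
      simp only [pathFlow, sum_add_distrib]
      by_cases h : u = a
      · simp [h]
        omega
      · simp [h, Ne.symm h]

lemma sum_pathFlow_in (l : List V) (v : V) :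
    ∑ u, pathFlow l u v + (if l.head? = some v then 1 else 0) = l.count v := by
  induction l with
  | nil => simp [pathFlow]
  | cons a l ih =>
    cases l with
    | nil => simp [pathFlow, List.count_singleton]
    | cons b l =>
      rw [List.count_cons, ← ih]
      simp only [pathFlow, sum_add_distrib]
      by_cases h : v = b
      · simp [h]
        omega
      · simp [h, Ne.symm h]

/-- `S` is the vertex set of a `2`-eulerianizable subdigraph. -/
def Eul (A : V → V → Prop) (S : Set V) : Prop :=
  ∃ m, Circ A 2 m ∧ (∀ u v, 0 < m u v → u ∈ S ∧ v ∈ S) ∧ Conn m S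

lemma eul_of_dipaths {l l' : List V} {u v : V} (h : DipathFromTo A l u v)
    (h' : DipathFromTo A l' v u) : Eul A {x | x ∈ l ∨ x ∈ l'} := by
  obtain ⟨⟨hne, hnd, hch⟩, hhd, hlast⟩ := h
  obtain ⟨⟨hne', hnd', hch'⟩, hhd', hlast'⟩ := h'
  refine ⟨fun a b => pathFlow l a b + pathFlow l' a b, ⟨fun a b hab => ?_, fun x => ?_,
    fun x => ?_⟩, fun a b hab => ?_, ?_⟩
  · rcases Nat.eq_zero_or_pos (pathFlow l a b) with h0 | h0
    · exact adj_of_pathFlow_pos hch' (by omega)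
    · exact adj_of_pathFlow_pos hch h0
  · have h1 := sum_pathFlow_out l x
    have h2 := sum_pathFlow_in l x
    have h3 := sum_pathFlow_out l' x
    have h4 := sum_pathFlow_in l' x
    rw [hhd] at h2
    rw [hlast] at h1
    rw [hhd'] at h4
    rw [hlast'] at h3
    simp only [sum_add_distrib]
    omega
  · have h1 := sum_pathFlow_out l x
    have h3 := sum_pathFlow_out l' x
    have h5 := List.nodup_iff_count_le_one.1 hnd x
    have h6 := List.nodup_iff_count_le_one.1 hnd' x
    simp only [sum_add_distrib]
    omega
  · beta_reduce at hab
    rcases Nat.eq_zero_or_pos (pathFlow l a b) with h0 | h0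
    · exact (pathFlow_supp (show 0 < pathFlow l' a b by omega)).imp Or.inr Or.inr
    · exact (pathFlow_supp h0).imp Or.inl Or.inl
  · exact ((conn_pathFlow l).mono fun _ _ => Nat.le_add_right _ _).union
      ((conn_pathFlow l').mono fun _ _ => Nat.le_add_left _ _)
      ⟨u, List.mem_of_mem_head? hhd, List.mem_of_mem_getLast? hlast'⟩

/-- Disjoint `2`-eulerianizable subdigraphs form a family. -/
lemma fam_of_eul {ι : Type} [Fintype ι] {p : ι → Set V} (h : ∀ k, Eul A (p k))
    (hd : ∀ k l, k ≠ l → Disjoint (p k) (p l)) : Fam A p := by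
  choose m h1 h2 h3 using h
  have huniq : ∀ v, ∃ k₀ : Option ι, ∀ k, v ∈ p k → k₀ = some k := by
    intro v
    by_cases hv : ∃ k, v ∈ p k
    · obtain ⟨k, hk⟩ := hv
      refine ⟨some k, fun l hl => ?_⟩
      by_contra hkl
      exact Set.disjoint_left.1 (hd k l fun h => hkl (by rw [h])) hk hl
    · push Not at hv
      exact ⟨none, fun k hk => absurd hk (hv k)⟩
  refine ⟨fun u v => ∑ k, m k u v, ⟨fun u v huv => ?_, fun v => ?_, fun v => ?_⟩,
    fun k => (h3 k).mono fun u v => single_le_sum (f := fun k => m k u v)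
      (fun _ _ => Nat.zero_le _) (mem_univ k), fun v => ?_⟩
  · obtain ⟨k, -, hk⟩ := exists_ne_zero_of_sum_ne_zero huv.ne'
    exact (h1 k).supp u v (Nat.pos_of_ne_zero hk)
  · rw [sum_comm, sum_comm (t := univ (α := ι))]
    exact sum_congr rfl fun k _ => (h1 k).bal v
  · rw [sum_comm]
    have hz : ∀ k, v ∉ p k → ∑ u, m k v u = 0 := fun k hk => sum_eq_zero fun u _ => by
      by_contra hne
      exact hk (h2 k v u (Nat.pos_of_ne_zero hne)).1
    by_cases hv : ∃ k, v ∈ p k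
    · obtain ⟨k, hk⟩ := hv
      rw [sum_eq_single k (fun l _ hl => hz l fun hvl =>
        Set.disjoint_left.1 (hd k l hl.symm) hk hvl) (by simp)]
      exact (h1 k).le v
    · push Not at hv
      simp [fun k => hz k (hv k)]
  · refine le_trans (card_le_one.2 fun k hk l hl => ?_) one_le_two
    by_contra hkl
    exact Set.disjoint_left.1 (hd k l hkl) (by simpa using hk) (by simpa using hl)

lemma IsLinkage.sum_out (h : IsLinkage A S T P τ) (hc : #S = #T) (x : V) :
    ∑ v, linkFlow S P x v + (if x ∈ T then 1 else 0) = ∑ a ∈ S, (P a).count x := by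
  simp only [← sum_pathFlow_out, sum_add_distrib]
  unfold linkFlow
  rw [sum_comm]
  congr 1
  rw [← h.image_eq hc]
  rw [sum_congr rfl fun a ha => by rw [(h.1 a ha).2.2.2]]
  simp only [Option.some.injEq, mem_image]
  split_ifs with hx
  · obtain ⟨a, ha, rfl⟩ := hx
    rw [sum_eq_single_of_mem a ha fun b hb hba => if_neg fun he => hba (h.injOn hb ha he)]
    simp
  · push Not at hx
    exact (sum_eq_zero fun a ha => if_neg (hx a ha)).symm

lemma IsLinkage.sum_in (h : IsLinkage A S T P τ) (x : V) :
    ∑ u, linkFlow S P u x + (if x ∈ S then 1 else 0) = ∑ a ∈ S, (P a).count x := by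
  simp only [← sum_pathFlow_in, sum_add_distrib]
  unfold linkFlow
  rw [sum_comm]
  congr 1
  rw [sum_congr rfl fun a ha => by rw [(h.1 a ha).2.2.1]]
  simp

/-- Two opposite linkages between the same sets form a circulation. -/
lemma IsLinkage.circ (h : IsLinkage A S T P τ) (h' : IsLinkage A T S Q τ') (hc : #S = #T) :
    Circ A 2 (fun u v => linkFlow S P u v + linkFlow T Q u v) := by
  have hs : ∀ {S T : Finset V} {P : V → List V} {τ : V → V}, IsLinkage A S T P τ →
      ∀ u v, 0 < linkFlow S P u v → A u v := by
    intro S T P τ h u v huv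
    obtain ⟨a, ha, hne⟩ := exists_ne_zero_of_sum_ne_zero huv.ne'
    exact adj_of_pathFlow_pos (h.1 a ha).2.1.2.2 (Nat.pos_of_ne_zero hne)
  refine ⟨fun u v huv => ?_, fun x => ?_, fun x => ?_⟩
  · rcases Nat.eq_zero_or_pos (linkFlow S P u v) with h0 | h0
    · exact hs h' u v (by omega)
    · exact hs h u v h0
  · have h1 := h.sum_out hc x
    have h2 := h.sum_in x
    have h3 := h'.sum_out hc.symm x
    have h4 := h'.sum_in x
    simp only [sum_add_distrib]
    omega
  · have h1 := h.sum_out hc x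
    have h3 := h'.sum_out hc.symm x
    have h5 := h.sum_count_le x
    have h6 := h'.sum_count_le x
    simp only [sum_add_distrib]
    omega

/-- The paths of a linkage between subsets of a linked set form a family. -/
lemma IsLinkage.fam {X : Finset V} (h : IsLinkage A S T P τ) (hX : Linked A X) (hS : S ⊆ X)
    (hT : T ⊆ X) (hc : #S = #T) {ι : Type} [Fintype ι] {e : ι → V} (he : Function.Injective e)
    (heS : ∀ i, e i ∈ S) : Fam A (fun i => {x | x ∈ P (e i)}) := by
  obtain ⟨Q, τ', h'⟩ := hX T S hT hS hc.symm
  refine ⟨_, h.circ h' hc, fun i => (conn_pathFlow _).mono fun u v =>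
    (pathFlow_le_linkFlow (heS i) u v).trans (Nat.le_add_right _ _), fun v => ?_⟩
  refine le_trans (card_le_one.2 fun k hk l hl => ?_) one_le_two
  simp only [Set.mem_ofPred_eq, mem_filter, mem_univ, true_and] at hk hl
  exact he (h.eq_of_mem (heS k) (heS l) hk hl)

end Linkages

section Orbits
open Classical Finset

variable {V : Type} {Y : Finset V} {s : V → V}

lemma iterate_mem_of_mapsTo (hs : ∀ y ∈ Y, s y ∈ Y) {y : V} (hy : y ∈ Y) (i : ℕ) :
    s^[i] y ∈ Y := by
  induction i with
  | zero => exact hy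
  | succ i ih => rw [Function.iterate_succ_apply']; exact hs _ ih

lemma exists_iterate_eq_self (hs : ∀ y ∈ Y, s y ∈ Y) (hinj : Set.InjOn s Y) {y : V} (hy : y ∈ Y)
    {i j : ℕ} (hij : i ≤ j) (h : s^[i] y = s^[j] y) : s^[j - i] y = y := by
  induction i generalizing j with
  | zero => exact h.symm
  | succ i ih =>
    obtain ⟨j, rfl⟩ : ∃ j', j = j' + 1 := ⟨j - 1, by omega⟩
    rw [Function.iterate_succ_apply', Function.iterate_succ_apply'] at h
    have := ih (by omega) (hinj (iterate_mem_of_mapsTo hs hy i) (iterate_mem_of_mapsTo hs hy j) h)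
    rwa [Nat.add_sub_add_right]

/-- A permutation all of whose cycles are short has many disjoint cycles. -/
lemma exists_disjoint_orbits (hs : ∀ y ∈ Y, s y ∈ Y) (hinj : Set.InjOn s Y) {L c : ℕ}
    (hL : 0 < L) (hY : L * c ≤ #Y)
    (hper : ∀ y ∈ Y, ∃ p, 0 < p ∧ p ≤ L ∧ s^[p] y = y) :
    ∃ y : Fin c → V, (∀ k, y k ∈ Y) ∧
      (∀ k, ((range L).image fun i => s^[i] (y k)).image s = (range L).image fun i => s^[i] (y k)) ∧
      ∀ k l i j, i < L → j < L → s^[i] (y k) = s^[j] (y l) → k = l := by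
  set O : V → Finset V := fun y => (range L).image fun i => s^[i] y with hO
  have hself : ∀ y, y ∈ O y := fun y => mem_image.2 ⟨0, mem_range.2 hL, rfl⟩
  have hOY : ∀ y ∈ Y, O y ⊆ Y := fun y hy =>
    image_subset_iff.2 fun i _ => iterate_mem_of_mapsTo hs hy i
  have hcl : ∀ y ∈ Y, (O y).image s = O y := by
    intro y hy
    refine eq_of_subset_of_card_le (image_subset_iff.2 fun x hx => ?_)
      (card_image_of_injOn (hinj.mono (hOY y hy))).ge
    obtain ⟨i, hi, rfl⟩ := mem_image.1 hx
    rw [mem_range] at hi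
    rw [← Function.iterate_succ_apply' s i y]
    rcases Nat.lt_or_ge (i + 1) L with h | h
    · exact mem_image.2 ⟨i + 1, mem_range.2 h, rfl⟩
    · obtain ⟨p, hp, hpL, hpy⟩ := hper y hy
      refine mem_image.2 ⟨i + 1 - p, mem_range.2 (by omega), ?_⟩
      conv_rhs => rw [show i.succ = i + 1 - p + p by omega, Function.iterate_add_apply, hpy]
  have hback : ∀ y ∈ Y, ∀ x ∈ Y, ∀ i, s^[i] x ∈ O y → x ∈ O y := by
    intro y hy x hx i
    induction i with
    | zero => exact id
    | succ i ih =>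
      intro h
      rw [Function.iterate_succ_apply', ← hcl y hy] at h
      obtain ⟨w, hw, hwx⟩ := mem_image.1 h
      rw [hinj (hOY y hy hw) (iterate_mem_of_mapsTo hs hx i) hwx] at hw
      exact ih hw
  have hfwd : ∀ y ∈ Y, ∀ x ∈ O y, ∀ i, s^[i] x ∈ O y := by
    intro y hy x hx i
    induction i with
    | zero => exact hx
    | succ i ih =>
      rw [Function.iterate_succ_apply', ← hcl y hy]
      exact mem_image_of_mem s ih
  have hsub : ∀ y ∈ Y, ∀ x ∈ Y, ∀ w ∈ O x, w ∈ O y → O x ⊆ O y := by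
    intro y hy x hx w hwx hwy
    obtain ⟨i, -, rfl⟩ := mem_image.1 hwx
    exact image_subset_iff.2 fun j _ => hfwd y hy x (hback y hy x hx i hwy) j
  have hcard : c ≤ #(Y.image O) := by
    have hOc : ∀ y, #(O y) ≤ L := fun y => card_image_le.trans (card_range L).le
    have h1 : #Y ≤ L * #(Y.image O) := by
      refine card_le_mul_card_image Y L fun b hb => ?_
      obtain ⟨y, -, rfl⟩ := mem_image.1 hb
      exact (card_le_card fun x hx => (mem_filter.1 hx).2 ▸ hself x).trans (hOc y)
    exact Nat.le_of_mul_le_mul_left (hY.trans h1) hL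
  obtain ⟨C, hC, hCc⟩ := exists_subset_card_eq hcard
  have hrep : ∀ k : Fin c, ∃ y ∈ Y, O y = (C.equivFinOfCardEq hCc).symm k := fun k =>
    mem_image.1 (hC ((C.equivFinOfCardEq hCc).symm k).2)
  choose y hy hyO using hrep
  refine ⟨y, hy, fun k => hcl _ (hy k), fun k l i j hi hj h => ?_⟩
  have h1 : s^[i] (y k) ∈ O (y k) := mem_image.2 ⟨i, mem_range.2 hi, rfl⟩
  have h2 : s^[i] (y k) ∈ O (y l) := h ▸ mem_image.2 ⟨j, mem_range.2 hj, rfl⟩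
  have h3 : O (y k) = O (y l) :=
    (hsub _ (hy l) _ (hy k) _ h1 h2).antisymm (hsub _ (hy k) _ (hy l) _ h2 h1)
  rw [hyO, hyO] at h3
  exact (C.equivFinOfCardEq hCc).symm.injective (Subtype.ext h3)

end Orbits

section Segments
open Classical Finset

variable {V : Type} {A : V → V → Prop} {Y Y' : Finset V} {P Q : V → List V} {τ τ' : V → V}

/-- The vertices of the part of an alternating walk through two opposite linkages `P`, `Q`
that starts at the vertices `z i` with `a ≤ i < b`. -/
def seg (P Q : V → List V) (τ : V → V) (z : ℕ → V) (a b : ℕ) : Set V :=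
  {x | ∃ i, a ≤ i ∧ i < b ∧ (x ∈ P (z i) ∨ x ∈ Q (τ (z i)))}

variable {z : ℕ → V}

lemma conn_seg (h : IsLinkage A Y Y' P τ) (h' : IsLinkage A Y' Y Q τ') (hz : ∀ i, z i ∈ Y)
    (hs : ∀ i, z (i + 1) = τ' (τ (z i))) {m : V → V → ℕ} {a b : ℕ}
    (hP : ∀ i, a ≤ i → i < b → ∀ u v, pathFlow (P (z i)) u v ≤ m u v)
    (hQ : ∀ i, a ≤ i → i < b → ∀ u v, pathFlow (Q (τ (z i))) u v ≤ m u v) :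
    Conn m (seg P Q τ z a b) := by
  have hτ : ∀ i, τ (z i) ∈ Y' := fun i => (h.1 _ (hz i)).1
  induction b with
  | zero => rintro U ⟨x, ⟨i, hi, hi', -⟩, -⟩; omega
  | succ b ih =>
    specialize ih (fun i h1 h2 => hP i h1 (by omega)) fun i h1 h2 => hQ i h1 (by omega)
    rcases Nat.lt_or_ge b a with hab | hab
    · rintro U ⟨x, ⟨i, hi, hi', -⟩, -⟩; omega
    have hcell : Conn m ({x | x ∈ P (z b)} ∪ {x | x ∈ Q (τ (z b))}) :=
      ((conn_pathFlow _).mono (hP b hab (by omega))).union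
        ((conn_pathFlow _).mono (hQ b hab (by omega)))
        ⟨τ (z b), h.last_mem (hz b), h'.head_mem (hτ b)⟩
    have heq : seg P Q τ z a (b + 1) =
        seg P Q τ z a b ∪ ({x | x ∈ P (z b)} ∪ {x | x ∈ Q (τ (z b))}) := by
      ext x
      constructor
      · rintro ⟨i, hi, hi', hx⟩
        rcases Nat.lt_succ_iff_lt_or_eq.1 hi' with hlt | rfl
        · exact Or.inl ⟨i, hi, hlt, hx⟩
        · exact Or.inr hx
      · rintro (⟨i, hi, hi', hx⟩ | hx)
        · exact ⟨i, hi, by omega, hx⟩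
        · exact ⟨b, hab, by omega, hx⟩
    rw [heq]
    rcases hab.eq_or_lt with rfl | hlt
    · have : seg P Q τ z a a = ∅ := by
        ext x
        simp only [seg, Set.mem_ofPred_eq, Set.mem_empty_iff_false, iff_false]
        rintro ⟨i, hi, hi', -⟩
        omega
      rwa [this, Set.empty_union]
    · obtain ⟨b, rfl⟩ : ∃ b', b = b' + 1 := ⟨b - 1, by omega⟩
      refine ih.union hcell ⟨z (b + 1), ⟨b, by omega, by omega, Or.inr ?_⟩,
        Or.inl (h.head_mem (hz _))⟩
      rw [hs]
      exact h'.last_mem (hτ b)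

lemma reachIn_seg (h : IsLinkage A Y Y' P τ) (h' : IsLinkage A Y' Y Q τ') (hz : ∀ i, z i ∈ Y)
    (hs : ∀ i, z (i + 1) = τ' (τ (z i))) {a b i j : ℕ} (hi : a ≤ i) (hij : i ≤ j) (hj : j < b) :
    ReachIn A (seg P Q τ z a b) (z i) (τ (z j)) := by
  have hτ : ∀ i, τ (z i) ∈ Y' := fun i => (h.1 _ (hz i)).1
  have hstep : ∀ j, a ≤ j → j < b → ReachIn A (seg P Q τ z a b) (z j) (τ (z j)) := fun j hj hjb =>
    reachIn_of_isChain (h.1 _ (hz j)).2.1.2.2 (fun w hw => ⟨j, hj, hjb, Or.inl hw⟩)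
      (h.1 _ (hz j)).2.2.1 (h.1 _ (hz j)).2.2.2
  induction j, hij using Nat.le_induction with
  | base => exact hstep i hi hj
  | succ j hij ih =>
    refine ((ih (by omega)).trans ?_).trans (hstep (j + 1) (by omega) hj)
    rw [hs]
    exact reachIn_of_isChain (h'.1 _ (hτ j)).2.1.2.2
      (fun w hw => ⟨j, by omega, by omega, Or.inr hw⟩) (h'.1 _ (hτ j)).2.2.1 (h'.1 _ (hτ j)).2.2.2

variable [Fintype V]

lemma fam_seg {ι : Type} [Fintype ι] (h : IsLinkage A Y Y' P τ) (h' : IsLinkage A Y' Y Q τ')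
    (hc : #Y = #Y') {z : ι → ℕ → V} (hz : ∀ k i, z k i ∈ Y)
    (hs : ∀ k i, z k (i + 1) = τ' (τ (z k i))) {a b : ι → ℕ}
    (hd : ∀ k l i j, a k ≤ i → i < b k → a l ≤ j → j < b l → z k i = z l j → k = l) :
    Fam A fun k => seg P Q τ (z k) (a k) (b k) := by
  have hτ : ∀ k i, τ (z k i) ∈ Y' := fun k i => (h.1 _ (hz k i)).1
  refine ⟨_, h.circ h' hc, fun k => conn_seg h h' (hz k) (hs k)
    (fun i _ _ u v => (pathFlow_le_linkFlow (hz k i) u v).trans (Nat.le_add_right _ _))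
    (fun i _ _ u v => (pathFlow_le_linkFlow (hτ k i) u v).trans (Nat.le_add_left _ _)),
    fun v => ?_⟩
  have hsub : ({k | v ∈ seg P Q τ (z k) (a k) (b k)} : Finset ι) ⊆
      ({k | ∃ i, a k ≤ i ∧ i < b k ∧ v ∈ P (z k i)} : Finset ι) ∪
        ({k | ∃ i, a k ≤ i ∧ i < b k ∧ v ∈ Q (τ (z k i))} : Finset ι) := by
    intro k hk
    obtain ⟨i, h1, h2, h3⟩ := (mem_filter.1 hk).2
    rcases h3 with h3 | h3
    · exact mem_union_left _ (mem_filter.2 ⟨mem_univ _, i, h1, h2, h3⟩)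
    · exact mem_union_right _ (mem_filter.2 ⟨mem_univ _, i, h1, h2, h3⟩)
  refine (card_le_card hsub).trans ((card_union_le _ _).trans (Nat.add_le_add (b := 1) (d := 1)
    (card_le_one.2 fun k hk l hl => ?_) (card_le_one.2 fun k hk l hl => ?_)))
  all_goals
    obtain ⟨i, h1, h2, h3⟩ := (mem_filter.1 hk).2
    obtain ⟨j, h4, h5, h6⟩ := (mem_filter.1 hl).2
    refine hd k l i j h1 h2 h4 h5 ?_
  · exact h.eq_of_mem (hz k i) (hz l j) h3 h6
  · exact h.injOn (hz k i) (hz l j) (h'.eq_of_mem (hτ k i) (hτ l j) h3 h6)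

/-- A closed alternating walk is `2`-eulerianizable. -/
lemma eul_seg (h : IsLinkage A Y Y' P τ) (h' : IsLinkage A Y' Y Q τ') (hz : ∀ i, z i ∈ Y)
    (hs : ∀ i, z (i + 1) = τ' (τ (z i))) {L : ℕ}
    (hcl : ((range L).image z).image (fun y => τ' (τ y)) = (range L).image z) :
    Eul A (seg P Q τ z 0 L) := by
  have hτ : ∀ i, τ (z i) ∈ Y' := fun i => (h.1 _ (hz i)).1
  set O := (range L).image z
  have hOY : O ⊆ Y := image_subset_iff.2 fun i _ => hz i
  have hOY' : O.image τ ⊆ Y' := image_subset_iff.2 fun y hy => (h.1 y (hOY hy)).1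
  have h1 := h.restrict hOY
  have h2 := h'.restrict hOY'
  rw [image_image (s := O), show τ' ∘ τ = fun y => τ' (τ y) from rfl, hcl] at h2
  refine ⟨_, h1.circ h2 (card_image_of_injOn h1.injOn).symm, fun u v huv => ?_,
    conn_seg h h' hz hs (fun i _ hi u v => ?_) fun i _ hi u v => ?_⟩
  · beta_reduce at huv
    rcases Nat.eq_zero_or_pos (linkFlow O P u v) with h0 | h0
    · obtain ⟨y, hy, hne⟩ := exists_ne_zero_of_sum_ne_zero
        (show linkFlow (O.image τ) Q u v ≠ 0 by omega)
      obtain ⟨w, hw, rfl⟩ := mem_image.1 hy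
      obtain ⟨i, hi, rfl⟩ := mem_image.1 hw
      exact (pathFlow_supp (Nat.pos_of_ne_zero hne)).imp
        (fun h => ⟨i, Nat.zero_le _, mem_range.1 hi, Or.inr h⟩)
        (fun h => ⟨i, Nat.zero_le _, mem_range.1 hi, Or.inr h⟩)
    · obtain ⟨w, hw, hne⟩ := exists_ne_zero_of_sum_ne_zero h0.ne'
      obtain ⟨i, hi, rfl⟩ := mem_image.1 hw
      exact (pathFlow_supp (Nat.pos_of_ne_zero hne)).imp
        (fun h => ⟨i, Nat.zero_le _, mem_range.1 hi, Or.inl h⟩)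
        (fun h => ⟨i, Nat.zero_le _, mem_range.1 hi, Or.inl h⟩)
  · exact (pathFlow_le_linkFlow (mem_image_of_mem z (mem_range.2 hi)) u v).trans
      (Nat.le_add_right _ _)
  · exact (pathFlow_le_linkFlow
      (mem_image_of_mem τ (mem_image_of_mem z (mem_range.2 hi))) u v).trans
      (Nat.le_add_left _ _)

end Segments

section Connectors
open Classical Finset

variable {V : Type} [Fintype V] {A : V → V → Prop} {X Y Y' : Finset V} {P Q : V → List V}
  {τ τ' : V → V}

/-- A long alternating walk through two opposite linkages gives many disjoint
`2`-eulerianizable subdigraphs meeting both sides. -/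
lemma exists_connectors_of_walk {n c q T : ℕ}
    (hqT : ∀ (S : Fin q → Set V) (r : Fin q → Fin T → Set V), Fam A S → (∀ k, Fam A (r k)) →
      HasEulerianHaven A n ∨ ∃ (k : Fin c → Fin q) (a : Fin c → Fin T),
        ∀ i j, i ≠ j → Disjoint (S (k i) ∪ r (k i) (a i)) (S (k j) ∪ r (k j) (a j)))
    (hX : Linked A X) (hY : Y ⊆ X) (hY' : Y' ⊆ X) (hc : #Y = #Y')
    (h : IsLinkage A Y Y' P τ) (h' : IsLinkage A Y' Y Q τ') {z : ℕ → V} (hz : ∀ i, z i ∈ Y)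
    (hs : ∀ i, z (i + 1) = τ' (τ (z i)))
    (hinj : ∀ i j, i < 2 * T * q → j < 2 * T * q → z i = z j → i = j) :
    HasEulerianHaven A n ∨ ∃ p : Fin c → Set V, (∀ k, Eul A (p k)) ∧
      (∀ k l, k ≠ l → Disjoint (p k) (p l)) ∧ ∀ k, (p k ∩ Y).Nonempty ∧ (p k ∩ Y').Nonempty := by
  have hτ : ∀ i, τ (z i) ∈ Y' := fun i => (h.1 _ (hz i)).1
  have hlt : ∀ k : Fin q, 2 * T * k + 2 * T ≤ 2 * T * q := fun k => by
    calc 2 * T * k + 2 * T = 2 * T * (k + 1) := by ring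
      _ ≤ 2 * T * q := Nat.mul_le_mul_left _ k.2
  have hS : Fam A fun k : Fin q => seg P Q τ z (2 * T * k) (2 * T * k + 2 * T) := by
    refine fam_seg (z := fun _ => z) h h' hc (fun _ => hz) (fun _ => hs)
      fun k l i j h1 h2 h3 h4 h5 => ?_
    have := hinj i j (h2.trans_le (hlt k)) (h4.trans_le (hlt l)) h5
    subst this
    have hpos : 0 < 2 * T := by omega
    have hk : i / (2 * T) = k :=
      Nat.div_eq_of_lt_le (by rwa [mul_comm]) (by rw [mul_comm]; linarith)
    have hl : i / (2 * T) = l :=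
      Nat.div_eq_of_lt_le (by rwa [mul_comm]) (by rw [mul_comm]; linarith)
    exact Fin.ext (hk.symm.trans hl)
  set e : Fin q → Fin T → V := fun k i => τ (z (2 * T * k + T + i)) with he
  set e' : Fin q → Fin T → V := fun k i => z (2 * T * k + i) with he'
  have einj : ∀ k, Function.Injective (e k) := fun k i j hij => by
    have h1 := hlt k
    have := hinj _ _ (by omega) (by omega) (h.injOn (hz _) (hz _) hij)
    exact Fin.ext (by omega)
  have einj' : ∀ k, Function.Injective (e' k) := fun k i j hij => by
    have h1 := hlt k
    have := hinj _ _ (by omega) (by omega) hij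
    exact Fin.ext (by omega)
  have hR : ∀ k, ∃ R ρ, IsLinkage A (univ.image (e k)) (univ.image (e' k)) R ρ := fun k =>
    hX _ _ (image_subset_iff.2 fun i _ => hY' (hτ _)) (image_subset_iff.2 fun i _ => hY (hz _))
      (by rw [card_image_of_injective _ (einj k), card_image_of_injective _ (einj' k)])
  choose R ρ hR using hR
  have hr : ∀ k, Fam A fun a : Fin T => {x | x ∈ R k (e k a)} := fun k =>
    (hR k).fam hX (image_subset_iff.2 fun i _ => hY' (hτ _))
      (image_subset_iff.2 fun i _ => hY (hz _))
      (by rw [card_image_of_injective _ (einj k), card_image_of_injective _ (einj' k)])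
      (einj k) fun i => mem_image_of_mem _ (mem_univ i)
  refine (hqT _ _ hS hr).imp_right ?_
  rintro ⟨k, a, hdisj⟩
  have hpath : ∀ i, ∃ l, DipathIn A (seg P Q τ z (2 * T * k i) (2 * T * k i + 2 * T)) l ∧
      DipathFromTo A l (ρ (k i) (e (k i) (a i))) (e (k i) (a i)) := by
    intro i
    obtain ⟨j, -, hj⟩ := mem_image.1 ((hR (k i)).1 _ (mem_image_of_mem _ (mem_univ (a i)))).1
    rw [← hj]
    obtain ⟨l, hl, h1, h2⟩ := exists_dipath_of_reachIn
      (C := seg P Q τ z (2 * T * k i) (2 * T * k i + 2 * T)) (v := e (k i) (a i))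
      ⟨2 * T * k i + T + a i, by omega, by omega, Or.inl (h.last_mem (hz _))⟩
      (reachIn_seg (i := 2 * T * k i + j) h h' hz hs (by omega) (by omega) (by omega))
    exact ⟨l, hl, hl.1, h1, h2⟩
  choose l hl hl' using hpath
  refine ⟨fun i => {x | x ∈ l i ∨ x ∈ R (k i) (e (k i) (a i))},
    fun i => eul_of_dipaths (hl' i) ((hR (k i)).1 _ (mem_image_of_mem _ (mem_univ (a i)))).2,
    fun i j hij => (hdisj i j hij).mono (Set.union_subset_union (hl i).2 fun _ => id)
      (Set.union_subset_union (hl j).2 fun _ => id), fun i => ⟨?_, ?_⟩⟩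
  · obtain ⟨j, -, hj⟩ := mem_image.1 ((hR (k i)).1 _ (mem_image_of_mem _ (mem_univ (a i)))).1
    exact ⟨_, Or.inl (List.mem_of_mem_head? (hl' i).2.1), hj ▸ hz _⟩
  · exact ⟨_, Or.inl (List.mem_of_mem_getLast? (hl' i).2.2), hτ _⟩

/-- Two large subsets of a linked set are joined by many disjoint `2`-eulerianizable
subdigraphs, unless there is an eulerianizable subdigraph with a haven of large order. -/
lemma exists_connectors (n c : ℕ) :
    ∃ M : ℕ, ∀ (V : Type) [Fintype V] (A : V → V → Prop) (X Y Y' : Finset V), Linked A X →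
      Y ⊆ X → Y' ⊆ X → #Y = #Y' → M ≤ #Y →
      HasEulerianHaven A n ∨ ∃ p : Fin c → Set V, (∀ k, Eul A (p k)) ∧
        (∀ k l, k ≠ l → Disjoint (p k) (p l)) ∧
        ∀ k, (p k ∩ Y).Nonempty ∧ (p k ∩ Y').Nonempty := by
  obtain ⟨q, T, hqT⟩ := exists_disjoint_closures n c
  obtain ⟨c', hc'⟩ := exists_disjoint_tuples n Unit c
  refine ⟨(2 * T * q + 1) * c', fun V _ A X Y Y' hX hY hY' hc hM => ?_⟩
  obtain ⟨P, τ, h⟩ := hX Y Y' hY hY' hc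
  obtain ⟨Q, τ', h'⟩ := hX Y' Y hY' hY hc.symm
  set s : V → V := fun y => τ' (τ y) with hs
  have hsY : ∀ y ∈ Y, s y ∈ Y := fun y hy => (h'.1 _ (h.1 y hy).1).1
  have hsinj : Set.InjOn s Y := fun y hy y' hy' hyy =>
    h.injOn hy hy' (h'.injOn (h.1 y hy).1 (h.1 y' hy').1 hyy)
  have hwalk : ∀ y i, s^[i + 1] y = τ' (τ (s^[i] y)) := fun y i => by
    rw [Function.iterate_succ_apply']
  by_cases hlong : ∃ y ∈ Y, ∀ i j, i < 2 * T * q → j < 2 * T * q → s^[i] y = s^[j] y → i = j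
  · obtain ⟨y, hy, hinj⟩ := hlong
    exact exists_connectors_of_walk (hqT V A) hX hY hY' hc h h'
      (iterate_mem_of_mapsTo hsY hy) (hwalk y) hinj
  push Not at hlong
  have hper : ∀ y ∈ Y, ∃ p, 0 < p ∧ p ≤ 2 * T * q + 1 ∧ s^[p] y = y := by
    intro y hy
    obtain ⟨i, j, hi, hj, heq, hne⟩ := hlong y hy
    rcases hne.lt_or_gt with hlt | hlt
    · exact ⟨j - i, by omega, by omega, exists_iterate_eq_self hsY hsinj hy hlt.le heq⟩
    · exact ⟨i - j, by omega, by omega, exists_iterate_eq_self hsY hsinj hy hlt.le heq.symm⟩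
  obtain ⟨y, hy, hcl, hdisj⟩ := exists_disjoint_orbits hsY hsinj (Nat.succ_pos _) hM hper
  have hz := fun k => iterate_mem_of_mapsTo hsY (hy k)
  have hF : Fam A fun k => seg P Q τ (fun i => s^[i] (y k)) 0 (2 * T * q + 1) :=
    fam_seg h h' hc hz (fun k => hwalk (y k)) fun k l i j _ hi _ hj => hdisj k l i j hi hj
  refine (hc' V A (fun _ => _) fun _ => hF).imp_right ?_
  rintro ⟨f, -, hf⟩
  refine ⟨fun k => seg P Q τ (fun i => s^[i] (y (f k))) 0 (2 * T * q + 1),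
    fun k => eul_seg h h' (hz _) (hwalk _) (hcl _), fun k l hkl => hf k l hkl () (),
    fun k => ⟨⟨y (f k), ⟨0, le_rfl, Nat.succ_pos _, Or.inl (h.head_mem (hy _))⟩, hy _⟩,
      ⟨τ (y (f k)), ⟨0, le_rfl, Nat.succ_pos _, Or.inl (h.last_mem (hy _))⟩, (h.1 _ (hy _)).1⟩⟩⟩

end Connectors

section Chains
open Classical Finset

lemma StrongOn.mono_adj {V : Type} {A A' : V → V → Prop} {S : Set V} (h : StrongOn A S)
    (hA : ∀ u ∈ S, ∀ v ∈ S, A u v → A' u v) : StrongOn A' S := by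
  rw [strongOn_iff_reachIn] at *
  exact fun u hu v hv => Relation.ReflTransGen.mono
    (fun a b hab => ⟨hA a hab.2.1 b hab.2.2 hab.1, hab.2⟩) _ _ (h u hu v hv)

lemma Eul.strongOn {V : Type} [Fintype V] {A : V → V → Prop} {S : Set V} (h : Eul A S) :
    StrongOn A S := by
  obtain ⟨m, h1, h2, h3⟩ := h
  exact (eulerianizable_of_circ h1 h2 h3).1.mono_adj fun u _ v _ => h1.supp u v

lemma fam_singleton {V : Type} [Fintype V] (A : V → V → Prop) {ι : Type} [Fintype ι] {x : ι → V}
    (hx : Function.Injective x) : Fam A fun k => {x k} := by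
  refine ⟨fun _ _ => 0, ⟨by simp, by simp, by simp⟩, fun k => conn_singleton _ _, fun v => ?_⟩
  refine le_trans (card_le_one.2 fun k hk l hl => hx ?_) one_le_two
  simp only [Set.mem_singleton_iff, mem_filter, mem_univ, true_and] at hk hl
  exact hk.symm.trans hl

/-- A large linked set contains many sets of size `t + 1`, each inside a strongly connected
subdigraph covered by `t + 1` members of families. -/
lemma exists_chains (n t : ℕ) : ∀ c : ℕ, ∃ M : ℕ, ∀ (V : Type) [Fintype V] (A : V → V → Prop)
    (X X₁ : Finset V), Linked A X → X₁ ⊆ X → M ≤ #X₁ →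
    HasEulerianHaven A n ∨ ∃ (p : Fin (t + 1) → Fin c → Set V) (F : Fin c → Finset V)
      (y : Fin c → V), (∀ i, Fam A (p i)) ∧ (∀ k, F k ⊆ X₁ ∧ #(F k) = t + 1 ∧
        (F k : Set V) ⊆ ⋃ i, p i k) ∧ (∀ k, StrongOn A (⋃ i, p i k)) ∧ (∀ k, y k ∈ F k) ∧
      Function.Injective y := by
  induction t with
  | zero =>
    refine fun c => ⟨c, fun V _ A X X₁ hX hX₁ hc => Or.inr ?_⟩
    obtain ⟨C, hC, hCc⟩ := exists_subset_card_eq hc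
    set x : Fin c → V := fun k => (C.equivFinOfCardEq hCc).symm k with hx
    have hxi : Function.Injective x :=
      Subtype.val_injective.comp (C.equivFinOfCardEq hCc).symm.injective
    refine ⟨fun _ k => {x k}, fun k => {x k}, x, fun _ => fam_singleton A hxi,
      fun k => ⟨singleton_subset_iff.2 (hC (Subtype.prop _)), card_singleton _, ?_⟩, fun k => ?_,
      fun k => mem_singleton_self _, hxi⟩
    · simp
    · rw [Set.iUnion_const, strongOn_iff_reachIn]
      rintro u rfl v rfl
      exact Relation.ReflTransGen.refl
  | succ t ih =>
    intro c
    obtain ⟨c', hc'⟩ := exists_connectors n c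
    obtain ⟨M, hM⟩ := ih c'
    refine ⟨M + c', fun V _ A X X₁ hX hX₁ hle => ?_⟩
    obtain ⟨X₂, hX₂, hX₂c⟩ := exists_subset_card_eq (show M ≤ #X₁ by omega)
    obtain ⟨Y', hY', hY'c⟩ := exists_subset_card_eq
      (show c' ≤ #(X₁ \ X₂) by rw [card_sdiff_of_subset hX₂]; omega)
    rcases hM V A X X₂ hX (hX₂.trans hX₁) hX₂c.ge with hE | ⟨p, F, y, hp, hF, hst, hy, hyi⟩
    · exact Or.inl hE
    have hYc : #(univ.image y) = c' := by simp [card_image_of_injective _ hyi]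
    rcases hc' V A X (univ.image y) Y' hX
      (image_subset_iff.2 fun k _ => hX₁ (hX₂ ((hF k).1 (hy k))))
      (fun v hv => hX₁ (mem_sdiff.1 (hY' hv)).1) (hYc.trans hY'c.symm) hYc.ge with
      hE | ⟨E, hE, hEd, hEm⟩
    · exact Or.inl hE
    right
    have hg : ∀ k, ∃ l, y l ∈ E k := fun k => by
      obtain ⟨v, hv, hv'⟩ := (hEm k).1
      obtain ⟨l, -, rfl⟩ := mem_image.1 (mem_coe.1 hv')
      exact ⟨l, hv⟩
    choose g hg using hg
    choose z hzE hzY using fun k => (hEm k).2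
    have hgi : Function.Injective g := fun k l hkl => by
      by_contra hne
      exact Set.disjoint_left.1 (hEd k l hne) (hg k) (hkl ▸ hg l)
    have hzi : Function.Injective z := fun k l hkl => by
      by_contra hne
      exact Set.disjoint_left.1 (hEd k l hne) (hzE k) (hkl ▸ hzE l)
    have hzX : ∀ k, z k ∈ X₁ ∧ z k ∉ X₂ := fun k => mem_sdiff.1 (hY' (hzY k))
    have hU : ∀ k, (⋃ i, (Fin.cons E (fun i => p i ∘ g) : Fin (t + 1 + 1) → Fin c → Set V) i k) =
        E k ∪ ⋃ i, p i (g k) := fun k => by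
      ext v
      simp [Fin.exists_fin_succ]
    refine ⟨Fin.cons E fun i => p i ∘ g, fun k => insert (z k) (F (g k)), z,
      Fin.cases (fam_of_eul hE hEd) fun i => (hp i).comp hgi, fun k => ⟨?_, ?_, ?_⟩, fun k => ?_,
      fun k => mem_insert_self _ _, hzi⟩
    · exact insert_subset (hzX k).1 ((hF (g k)).1.trans hX₂)
    · rw [card_insert_of_notMem fun hz => (hzX k).2 ((hF _).1 hz), (hF _).2.1]
    · rw [hU, coe_insert]
      exact Set.insert_subset (Or.inl (hzE k)) ((hF (g k)).2.2.trans Set.subset_union_right)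
    · rw [hU]
      exact (hE k).strongOn.union (hst (g k)) ⟨y (g k), hg k, (hF _).2.2 (mem_coe.2 (hy _))⟩

end Chains

/-- For every `n ≥ 1` there is `N` such that every finite digraph containing
a linked set of size at least `N` either has a `4`-eulerianizable subdigraph with a haven of
order at least `n`, or contains a representation of the complete graph `K_n`. -/
theorem linked_gives_eulerianizable_or_clique_rep (n : ℕ) (hn : 0 < n) :
    ∃ N : ℕ, 0 < N ∧
      ∀ (V : Type) [Fintype V] [DecidableEq V] (A : V → V → Prop) (X : Finset V),
        Linked A X → N ≤ X.card →
        (∃ (S : Set V) (A' : V → V → Prop),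
          IsSubdigraph A S A' ∧ Eulerianizable A' S 4 ∧
          ∃ w, n ≤ w ∧ HasHavenOn A' S w) ∨
        Nonempty (DigraphRep V A (⊤ : SimpleGraph (Fin n))) := by
  classical
  let ι := {e : Sym2 (Fin n) // e ∈ (⊤ : SimpleGraph (Fin n)).edgeSet}
  obtain ⟨M, hM⟩ := exists_disjoint_tuples n ι (Fintype.card ι)
  obtain ⟨t, ht⟩ := exists_connectors n M
  obtain ⟨c, hc⟩ := exists_disjoint_tuples n (Fin (t + 1)) n
  obtain ⟨N, hN⟩ := exists_chains n t c
  refine ⟨N + 1, Nat.succ_pos N, fun V _ _ A X hX hle => ?_⟩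
  change HasEulerianHaven A n ∨ _
  rcases hN V A X X hX subset_rfl (by omega) with hE | ⟨p, F, y, hp, hF, hst, hy, -⟩
  · exact Or.inl hE
  rcases hc V A p hp with hE | ⟨f, -, hf⟩
  · exact Or.inl hE
  set C : Fin n → Set V := fun w => ⋃ i, p i (f w) with hC
  have hCd : ∀ w w', w ≠ w' → Disjoint (C w) (C w') := fun w w' hww => by
    simp only [hC, Set.disjoint_iUnion_left, Set.disjoint_iUnion_right]
    exact fun i j => hf w w' hww _ _
  by_cases hE : HasEulerianHaven A n
  · exact Or.inl hE
  have hconn : ∀ e : ι, ∃ q : Fin M → Set V, (∀ k, Eul A (q k)) ∧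
      (∀ k l, k ≠ l → Disjoint (q k) (q l)) ∧ ∀ k, ∀ w ∈ e.1, (q k ∩ C w).Nonempty := by
    rintro ⟨e, -⟩
    induction e using Sym2.ind with
    | h u v =>
      obtain ⟨q, h1, h2, h3⟩ := (ht V A X (F (f u)) (F (f v)) hX (hF _).1 (hF _).1
        ((hF _).2.1.trans (hF _).2.1.symm) (by rw [(hF _).2.1]; omega)).resolve_left hE
      refine ⟨q, h1, h2, fun k w hw => ?_⟩
      rcases Sym2.mem_iff.1 hw with rfl | rfl
      · exact (h3 k).1.mono (Set.inter_subset_inter_right _ (hF _).2.2)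
      · exact (h3 k).2.mono (Set.inter_subset_inter_right _ (hF _).2.2)
  choose q hq hqd hqm using hconn
  obtain ⟨f', -, hf'⟩ := (hM V A q fun e => fam_of_eul (hq e) (hqd e)).resolve_left hE
  set idx := Fintype.equivFin ι
  choose m hm hms hmc using fun e : ι => hq e (f' (idx e))
  refine Or.inr ⟨{
    vS := C
    vA := fun w u v => A u v ∧ u ∈ C w ∧ v ∈ C w
    eS := fun e =>
      if h : e ∈ (⊤ : SimpleGraph (Fin n)).edgeSet then q ⟨e, h⟩ (f' (idx ⟨e, h⟩)) else ∅
    eA := fun e u v => ∃ h : e ∈ (⊤ : SimpleGraph (Fin n)).edgeSet, 0 < m ⟨e, h⟩ u v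
    vSub := fun w u v h => h
    vNonempty := fun w => ⟨y (f w), (hF _).2.2 (hy _)⟩
    vStrong := fun w => (hst (f w)).mono_adj fun u hu v hv h => ⟨h, hu, hv⟩
    vDisj := hCd
    eSub := ?_
    eNonempty := ?_
    eEul := ?_
    eDisj := ?_
    meets := ?_ }⟩
  · rintro e he u v ⟨_, h⟩
    rw [dif_pos he]
    exact ⟨(hm ⟨e, he⟩).supp u v h, hms ⟨e, he⟩ u v h⟩
  · intro e he
    rw [dif_pos he]
    exact (hqm ⟨e, he⟩ _ e.out.1 (Sym2.out_fst_mem e)).mono Set.inter_subset_left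
  · intro e he
    rw [dif_pos he]
    simp only [exists_prop_of_true he]
    exact eulerianizable_of_circ (hm ⟨e, he⟩) (hms ⟨e, he⟩) (hmc ⟨e, he⟩)
  · intro e he e' he' hee
    rw [dif_pos he, dif_pos he']
    exact hf' _ _ (fun h => hee (congrArg Subtype.val (idx.injective h))) _ _
  · intro e he w hw
    rw [dif_pos he]
    exact hqm ⟨e, he⟩ _ w hw
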